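/- Change-of-variables formula for the contour (VV) integral over foliated singular manifolds (Theorem CVF-VV): Let γ be a path from Ω̃ = Ω × (ϑ₁,…,ϑₙ) into (m|n)-superspace with sdet J(γ) invertible, and set 𝔐 := γ(Ω̃). Let φ = (φ_0, φ_1) be a supersmooth diffeomorphism, with sdet J(φ) invertible, from a neighborhood of 𝔑 := δ(Ω̃) onto a neighborhood of 𝔐, where δ := φ^{-1}∘γ is again a path with sdet J(δ) invertible. Then for every supersmooth function u integrable on 𝔐, VV∬_𝔐 dxdθ u(x,θ) = VV∬_{φ^{-1}(𝔐)} dydω sdet J(φ)(y,ω)·u(φ(y,ω)), the right-hand side being the VV-integral along δ of the function sdet J(φ)·(u∘φ); equivalently, ∫_Ω dq [coefficient of ϑ₁⋯ϑₙ in sdet J(γ)(q,ϑ)·u(γ(q,ϑ))] = ∫_Ω dq [coefficient of ϑ₁⋯ϑₙ in sdet J(δ)(q,ϑ)·(sdet J(φ)·u∘φ)(δ(q,ϑ))]. -/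

import Mathlib

set_option synthInstance.maxHeartbeats 1000000
set_option maxHeartbeats 4000000

noncomputable section

open MeasureTheory

/-- Index type for the Grassmann generators: `L` generators `σ` (generating `Λ`) and three
banks of `n` odd generators (`θ₁,…,θₙ`, `ω₁,…,ωₙ`, `ϑ₁,…,ϑₙ`). -/
abbrev GIdx (L n : ℕ) : Type := Fin L ⊕ (Fin n ⊕ (Fin n ⊕ Fin n))

/- `E` is the (finite-dimensional) complex Grassmann algebra on the generators indexed by
`GIdx L n`, realized as a normed algebra identified with the exterior algebra via an algebra
isomorphism `g`. -/
variable {L m n : ℕ} {E : Type} [NormedRing E] [NormedAlgebra ℂ E] [CompleteSpace E]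

/-- A generator of `E` attached to a vector. -/
def gen (g : ExteriorAlgebra ℂ (GIdx L n → ℂ) ≃ₐ[ℂ] E) (v : GIdx L n → ℂ) : E :=
  g (ExteriorAlgebra.ι ℂ v)

/-- The generators `σ_i` of `Λ`. -/
def σg (g : ExteriorAlgebra ℂ (GIdx L n → ℂ) ≃ₐ[ℂ] E) (i : Fin L) : E :=
  gen g (Pi.single (Sum.inl i) 1)

/-- The odd generators `θ_k`. -/
def θg (g : ExteriorAlgebra ℂ (GIdx L n → ℂ) ≃ₐ[ℂ] E) (k : Fin n) : E :=
  gen g (Pi.single (Sum.inr (Sum.inl k)) 1)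

/-- The odd generators `ω_k`. -/
def ωg (g : ExteriorAlgebra ℂ (GIdx L n → ℂ) ≃ₐ[ℂ] E) (k : Fin n) : E :=
  gen g (Pi.single (Sum.inr (Sum.inr (Sum.inl k))) 1)

/-- The odd generators `ϑ_k`. -/
def ϑg (g : ExteriorAlgebra ℂ (GIdx L n → ℂ) ≃ₐ[ℂ] E) (k : Fin n) : E :=
  gen g (Pi.single (Sum.inr (Sum.inr (Sum.inr k))) 1)

/-- The even part `E_ev`. -/
def evenPart (g : ExteriorAlgebra ℂ (GIdx L n → ℂ) ≃ₐ[ℂ] E) : Submodule ℂ E :=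
  (CliffordAlgebra.evenOdd (0 : QuadraticForm ℂ (GIdx L n → ℂ)) 0).map g.toLinearMap

/-- The odd part `E_od`. -/
def oddPart (g : ExteriorAlgebra ℂ (GIdx L n → ℂ) ≃ₐ[ℂ] E) : Submodule ℂ E :=
  (CliffordAlgebra.evenOdd (0 : QuadraticForm ℂ (GIdx L n → ℂ)) 1).map g.toLinearMap

/-- The subalgebra `Λ ⊆ E` generated by the `σ`'s. -/
def ΛSub (g : ExteriorAlgebra ℂ (GIdx L n → ℂ) ≃ₐ[ℂ] E) : Subalgebra ℂ E :=
  Algebra.adjoin ℂ (Set.range (σg g))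

/-- The subalgebra of `E` generated by the `σ`'s and the `ϑ`'s. -/
def ΛϑSub (g : ExteriorAlgebra ℂ (GIdx L n → ℂ) ≃ₐ[ℂ] E) : Subalgebra ℂ E :=
  Algebra.adjoin ℂ (Set.range (σg g) ∪ Set.range (ϑg g))

/-- The body map `π_B : E → ℂ`. -/
def πB (g : ExteriorAlgebra ℂ (GIdx L n → ℂ) ≃ₐ[ℂ] E) : E →ₐ[ℂ] ℂ :=
  (ExteriorAlgebra.algebraMapInv).comp g.symm.toAlgHom

/-- The soul `x_S = x − π_B(x)·1` (nilpotent). -/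
def soul (g : ExteriorAlgebra ℂ (GIdx L n → ℂ) ≃ₐ[ℂ] E) (x : E) : E :=
  x - algebraMap ℂ E (πB g x)

/-- Contraction (left odd derivative) with respect to the generator indexed by `idx`. -/
def Dop (g : ExteriorAlgebra ℂ (GIdx L n → ℂ) ≃ₐ[ℂ] E) (idx : GIdx L n) : E →ₗ[ℂ] E :=
  g.toLinearMap ∘ₗ
    (CliffordAlgebra.contractLeft (Q := (0 : QuadraticForm ℂ (GIdx L n → ℂ)))
      (LinearMap.proj idx)) ∘ₗ g.symm.toLinearMap

/-- `∂_{θ_k}`. -/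
def Dθ (g : ExteriorAlgebra ℂ (GIdx L n → ℂ) ≃ₐ[ℂ] E) (k : Fin n) : E →ₗ[ℂ] E :=
  Dop g (Sum.inr (Sum.inl k))

/-- `∂_{ω_k}`. -/
def Dω (g : ExteriorAlgebra ℂ (GIdx L n → ℂ) ≃ₐ[ℂ] E) (k : Fin n) : E →ₗ[ℂ] E :=
  Dop g (Sum.inr (Sum.inr (Sum.inl k)))

/-- `∂_{ϑ_k}`. -/
def Dϑ (g : ExteriorAlgebra ℂ (GIdx L n → ℂ) ≃ₐ[ℂ] E) (k : Fin n) : E →ₗ[ℂ] E :=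
  Dop g (Sum.inr (Sum.inr (Sum.inr k)))

/-- The linear projection on generators keeping only the indices where `keep` is `true`. -/
def keepLin (L n : ℕ) (keep : GIdx L n → Bool) : (GIdx L n → ℂ) →ₗ[ℂ] (GIdx L n → ℂ) where
  toFun v idx := if keep idx then v idx else 0
  map_add' x y := by funext idx; by_cases h : keep idx <;> simp [h]
  map_smul' c x := by funext idx; by_cases h : keep idx <;> simp [h]

/-- The algebra endomorphism of `E` killing the generators where `keep` is `false`. -/
def evalKill (g : ExteriorAlgebra ℂ (GIdx L n → ℂ) ≃ₐ[ℂ] E) (keep : GIdx L n → Bool) :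
    E →ₐ[ℂ] E :=
  (g.toAlgHom.comp (CliffordAlgebra.map ⟨keepLin L n keep, fun _ => rfl⟩)).comp
    g.symm.toAlgHom

/-- indices other than the `θ` bank. -/
def notθ : GIdx L n → Bool := fun idx =>
  match idx with
  | .inr (.inl _) => false
  | _ => true

/-- indices other than the `ω` bank. -/
def notω : GIdx L n → Bool := fun idx =>
  match idx with
  | .inr (.inr (.inl _)) => false
  | _ => true

/-- indices other than the `ϑ` bank. -/
def notϑ : GIdx L n → Bool := fun idx =>
  match idx with
  | .inr (.inr (.inr _)) => false
  | _ => true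

/-- Berezin extraction of the `θ` top coefficient: `∂_{θ_n}⋯∂_{θ_1}(·)|_{θ=0}`. -/
def Bθ (g : ExteriorAlgebra ℂ (GIdx L n → ℂ) ≃ₐ[ℂ] E) (v : E) : E :=
  evalKill g notθ ((List.finRange n).foldl (fun w k => Dθ g k w) v)

/-- Berezin extraction of the `ω` top coefficient. -/
def Bω (g : ExteriorAlgebra ℂ (GIdx L n → ℂ) ≃ₐ[ℂ] E) (v : E) : E :=
  evalKill g notω ((List.finRange n).foldl (fun w k => Dω g k w) v)

/-- Berezin extraction of the `ϑ` top coefficient. -/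
def Bϑ (g : ExteriorAlgebra ℂ (GIdx L n → ℂ) ≃ₐ[ℂ] E) (v : E) : E :=
  evalKill g notϑ ((List.finRange n).foldl (fun w k => Dϑ g k w) v)

/-- `θ^a`, factors in increasing order. -/
def θpow (g : ExteriorAlgebra ℂ (GIdx L n → ℂ) ≃ₐ[ℂ] E) (a : Fin n → Bool) : E :=
  (List.ofFn fun k => if a k then θg g k else 1).prod

/-- `ω^a`, factors in increasing order. -/
def ωpow (g : ExteriorAlgebra ℂ (GIdx L n → ℂ) ≃ₐ[ℂ] E) (a : Fin n → Bool) : E :=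
  (List.ofFn fun k => if a k then ωg g k else 1).prod

/-- `ϑ^a`, factors in increasing order. -/
def ϑpow (g : ExteriorAlgebra ℂ (GIdx L n → ℂ) ≃ₐ[ℂ] E) (a : Fin n → Bool) : E :=
  (List.ofFn fun k => if a k then ϑg g k else 1).prod

/-- `w^a` for a tuple `w` of (odd) elements of `E`, factors in increasing order. -/
def oddprod (w : Fin n → E) (a : Fin n → Bool) : E :=
  (List.ofFn fun k => if a k then w k else 1).prod

/-- `|a|`: number of `1` entries of a multi-index `a ∈ {0,1}ⁿ`. -/
def mIdxCard {n : ℕ} (a : Fin n → Bool) : ℕ := (Finset.univ.filter fun k => a k).card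

/-- Determinant of a square matrix with entries in `E` (intended for even, hence central,
entries), as the signed sum over permutations of ordered products. -/
def detE {k : ℕ} (M : Matrix (Fin k) (Fin k) E) : E :=
  ∑ σ : Equiv.Perm (Fin k), (Equiv.Perm.sign σ : ℤ) • (List.ofFn fun i => M (σ i) i).prod

/-- Partial derivative `∂/∂q_j` of an `E`-valued function on `ℝ^m`. -/
def pd (j : Fin m) (f : (Fin m → ℝ) → E) : (Fin m → ℝ) → E :=
  fun q => fderiv ℝ f q (Pi.single j 1)

/-- Iterated partial derivatives along a list of directions. -/
def pdIter (l : List (Fin m)) (f : (Fin m → ℝ) → E) : (Fin m → ℝ) → E :=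
  l.foldl (fun h j => pd j h) f

/-- The list of directions attached to a multi-index `α ∈ ℕ^m`. -/
def mlist {m : ℕ} (α : Fin m → ℕ) : List (Fin m) :=
  (List.finRange m).flatMap fun j => List.replicate (α j) j

/-- The (real) body vector of a tuple of even elements. -/
def bodyVec (g : ExteriorAlgebra ℂ (GIdx L n → ℂ) ≃ₐ[ℂ] E) (x : Fin m → E) : Fin m → ℝ :=
  fun j => (πB g (x j)).re

/-- Grassmann continuation `f̃(x) = Σ_α (1/α!) (∂^α f)(π_B x)·x_S^α` of `f : ℝ^m → Λ`,
evaluated at a tuple `x` of even elements with real bodies; the sum is finite since souls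
are nilpotent (order `> L + 3n` terms vanish). -/
def gcont (g : ExteriorAlgebra ℂ (GIdx L n → ℂ) ≃ₐ[ℂ] E)
    (f : (Fin m → ℝ) → E) (x : Fin m → E) : E :=
  ∑ α ∈ Fintype.piFinset (fun _ : Fin m => Finset.range (L + 3 * n + 1)),
    (((∏ j, (α j).factorial : ℕ) : ℂ))⁻¹ •
      (pdIter (mlist α) f (bodyVec g x) * (List.ofFn fun j => soul g (x j) ^ α j).prod)

/-- Evaluation of a supersmooth function, given by its coefficient family
`c : {0,1}ⁿ → C^∞(ℝ^m, Λ)`, at a superpoint `(x, w)` (`x` even with real bodies, `w` odd):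
`Σ_a w^a·(c_a)~(x)`. -/
def seval (g : ExteriorAlgebra ℂ (GIdx L n → ℂ) ≃ₐ[ℂ] E)
    (c : (Fin n → Bool) → (Fin m → ℝ) → E) (x : Fin m → E) (w : Fin n → E) : E :=
  ∑ a : Fin n → Bool, oddprod w a * gcont g (c a) x

/-- The points of the superdomain over `W ⊆ ℝ^m` (coordinates in the `σ`-generated `Λ`). -/
def SPts (g : ExteriorAlgebra ℂ (GIdx L n → ℂ) ≃ₐ[ℂ] E) (W : Set (Fin m → ℝ))
    (y : Fin m → E) (w : Fin n → E) : Prop :=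
  (∀ i, y i ∈ ΛSub g ∧ y i ∈ evenPart g ∧ (πB g (y i)).im = 0) ∧
    bodyVec g y ∈ W ∧ ∀ k, w k ∈ ΛSub g ∧ w k ∈ oddPart g

/-- The coefficient family of the left odd derivative `∂_{ω_l}` of a supersmooth function
given by the coefficient family `c`. -/
def oddDerivCoeff (l : Fin n) (c : (Fin n → Bool) → (Fin m → ℝ) → E) :
    (Fin n → Bool) → (Fin m → ℝ) → E :=
  fun b q =>
    if b l then 0
    else ((-1 : ℂ) ^ ((Finset.univ.filter fun k => k < l ∧ b k).card)) •
      c (Function.update b l true) q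

/-- The even components of a path evaluated at `(q,ϑ)` (`ϑ` the concrete odd generators). -/
def pathEv0 (g : ExteriorAlgebra ℂ (GIdx L n → ℂ) ≃ₐ[ℂ] E)
    (c0 : Fin m → (Fin n → Bool) → (Fin m → ℝ) → E) (q : Fin m → ℝ) : Fin m → E :=
  fun j => ∑ a : Fin n → Bool, ϑpow g a * c0 j a q

/-- The odd components of a path evaluated at `(q,ϑ)`. -/
def pathEv1 (g : ExteriorAlgebra ℂ (GIdx L n → ℂ) ≃ₐ[ℂ] E)
    (c1 : Fin n → (Fin n → Bool) → (Fin m → ℝ) → E) (q : Fin m → ℝ) : Fin n → E :=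
  fun k => ∑ a : Fin n → Bool, ϑpow g a * c1 k a q

/-- The block `∂γ₀/∂q` of the super Jacobian of a path. -/
def pathJA (g : ExteriorAlgebra ℂ (GIdx L n → ℂ) ≃ₐ[ℂ] E)
    (c0 : Fin m → (Fin n → Bool) → (Fin m → ℝ) → E) (q : Fin m → ℝ) :
    Matrix (Fin m) (Fin m) E :=
  Matrix.of fun i j => pd i (fun p => ∑ a : Fin n → Bool, ϑpow g a * c0 j a p) q

/-- The Schur complement `∂γ₁/∂ϑ − (∂γ₀/∂ϑ)(∂γ₀/∂q)⁻¹(∂γ₁/∂q)` of the super Jacobian of a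
path, expressed through a two-sided inverse `P` of the block `∂γ₀/∂q`. -/
def pathSchur (g : ExteriorAlgebra ℂ (GIdx L n → ℂ) ≃ₐ[ℂ] E)
    (c0 : Fin m → (Fin n → Bool) → (Fin m → ℝ) → E)
    (c1 : Fin n → (Fin n → Bool) → (Fin m → ℝ) → E)
    (P : Matrix (Fin m) (Fin m) E) (q : Fin m → ℝ) : Matrix (Fin n) (Fin n) E :=
  (Matrix.of fun l k => Dϑ g l (∑ a : Fin n → Bool, ϑpow g a * c1 k a q))
    - (Matrix.of fun l j => Dϑ g l (∑ a : Fin n → Bool, ϑpow g a * c0 j a q)) * P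
      * (Matrix.of fun i k => pd i (fun p => ∑ a : Fin n → Bool, ϑpow g a * c1 k a p) q)

/-- The block `∂φ₀/∂y` of the super Jacobian of a supersmooth map `φ = (φ₀,φ₁)`, evaluated
at a superpoint `(y,w)`. -/
def mapJyy (g : ExteriorAlgebra ℂ (GIdx L n → ℂ) ≃ₐ[ℂ] E)
    (φ0c : Fin m → (Fin n → Bool) → (Fin m → ℝ) → E) (y : Fin m → E) (w : Fin n → E) :
    Matrix (Fin m) (Fin m) E :=
  Matrix.of fun i j => seval g (fun a => pd i (φ0c j a)) y w

/-- The Schur complement `∂φ₁/∂ω − (∂φ₀/∂ω)(∂φ₀/∂y)⁻¹(∂φ₁/∂y)` of the super Jacobian of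
`φ`, evaluated at a superpoint `(y,w)`, expressed through a two-sided inverse `P` of
`∂φ₀/∂y` there. -/
def mapSchur (g : ExteriorAlgebra ℂ (GIdx L n → ℂ) ≃ₐ[ℂ] E)
    (φ0c : Fin m → (Fin n → Bool) → (Fin m → ℝ) → E)
    (φ1c : Fin n → (Fin n → Bool) → (Fin m → ℝ) → E)
    (P : Matrix (Fin m) (Fin m) E) (y : Fin m → E) (w : Fin n → E) :
    Matrix (Fin n) (Fin n) E :=
  (Matrix.of fun l k => seval g (oddDerivCoeff l (φ1c k)) y w)
    - (Matrix.of fun l j => seval g (oddDerivCoeff l (φ0c j)) y w) * P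
      * (Matrix.of fun i k => seval g (fun a => pd i (φ1c k a)) y w)

section SuperJacobian

omit [CompleteSpace E]

section ExteriorAlgebraFiltration

variable {V : Type*} [AddCommGroup V] [Module ℂ V]

/-- The elements of the exterior algebra all of whose components have degree at least `k`. -/
def degreeGE (V : Type*) [AddCommGroup V] [Module ℂ V] (k : ℕ) :
    Submodule ℂ (ExteriorAlgebra ℂ V) :=
  ⨆ i, LinearMap.range (ExteriorAlgebra.ι ℂ (M := V)) ^ (k + i)

theorem degreeGE_mul_le (a b : ℕ) :
    degreeGE V a * degreeGE V b ≤ degreeGE V (a + b) := by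
  unfold degreeGE
  rw [Submodule.iSup_mul]
  refine iSup_le fun i => ?_
  rw [Submodule.mul_iSup]
  refine iSup_le fun j => ?_
  rw [← pow_add, show a + i + (b + j) = a + b + (i + j) by ring]
  exact le_iSup (fun i => LinearMap.range (ExteriorAlgebra.ι ℂ (M := V)) ^ (a + b + i)) (i + j)

theorem degreeGE_succ_le (k : ℕ) : degreeGE V (k + 1) ≤ degreeGE V k := by
  refine iSup_le fun i => ?_
  rw [show k + 1 + i = k + (1 + i) by ring]
  exact le_iSup (fun i => LinearMap.range (ExteriorAlgebra.ι ℂ (M := V)) ^ (k + i)) (1 + i)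

theorem ι_mem_degreeGE_one (v : V) : ExteriorAlgebra.ι ℂ v ∈ degreeGE V 1 :=
  Submodule.mem_iSup_of_mem 0 (by simp)

theorem sub_algebraMapInv_mem_degreeGE (x : ExteriorAlgebra ℂ V) :
    x - algebraMap ℂ _ (ExteriorAlgebra.algebraMapInv x) ∈ degreeGE V 1 := by
  induction x using ExteriorAlgebra.induction with
  | algebraMap r => rw [AlgHom.commutes, Algebra.algebraMap_self_apply, sub_self]; exact zero_mem _
  | ι v =>
    simpa [ExteriorAlgebra.algebraMapInv, ExteriorAlgebra.lift_ι_apply]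
      using ι_mem_degreeGE_one v
  | add a b ha hb =>
    have := add_mem ha hb
    rw [map_add, map_add]
    convert this using 1
    abel
  | mul a b ha hb =>
    have h2 := degreeGE_succ_le 1 (degreeGE_mul_le 1 1 (Submodule.mul_mem_mul ha hb))
    have h3 := Submodule.smul_mem _ (ExteriorAlgebra.algebraMapInv b) ha
    have h4 := Submodule.smul_mem _ (ExteriorAlgebra.algebraMapInv a) hb
    convert add_mem (add_mem h2 h3) h4 using 1
    have hs := Algebra.commutes (ExteriorAlgebra.algebraMapInv b) a
    have hr := Algebra.commutes (ExteriorAlgebra.algebraMapInv b)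
      (algebraMap ℂ (ExteriorAlgebra ℂ V) (ExteriorAlgebra.algebraMapInv a))
    rw [map_mul, map_mul, Algebra.smul_def, Algebra.smul_def, mul_sub, mul_sub, sub_mul, sub_mul,
      mul_sub, hs, hr]
    abel

theorem exteriorPower_eq_bot [Module.Finite ℂ V] {k : ℕ} (hk : Module.finrank ℂ V < k) :
    LinearMap.range (ExteriorAlgebra.ι ℂ (M := V)) ^ k = ⊥ := by
  have h : Module.finrank ℂ (⋀[ℂ]^k V) = 0 := by
    rw [exteriorPower.finrank_eq, Nat.choose_eq_zero_of_lt hk]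
  exact Submodule.finrank_eq_zero.mp h

theorem degreeGE_eq_bot [Module.Finite ℂ V] {k : ℕ} (hk : Module.finrank ℂ V < k) :
    degreeGE V k = ⊥ := by
  simp only [degreeGE, iSup_eq_bot]
  exact fun i => exteriorPower_eq_bot (by omega)

theorem prod_mem_degreeGE (l : List (ExteriorAlgebra ℂ V))
    (hl : ∀ x ∈ l, ExteriorAlgebra.algebraMapInv x = 0) : l.prod ∈ degreeGE V l.length := by
  induction l with
  | nil =>
    refine Submodule.mem_iSup_of_mem 0 ?_
    rw [List.prod_nil, List.length_nil, add_zero, pow_zero]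
    exact Submodule.one_le.mp le_rfl
  | cons a l ih =>
    rw [List.prod_cons, List.length_cons, add_comm]
    refine degreeGE_mul_le 1 _ (Submodule.mul_mem_mul ?_ (ih fun x hx => hl x (by simp [hx])))
    simpa [hl a (by simp)] using sub_algebraMapInv_mem_degreeGE a

instance ExteriorAlgebra.instFiniteDimensional [Module.Finite ℂ V] :
    FiniteDimensional ℂ (ExteriorAlgebra ℂ V) := by
  set N := Module.finrank ℂ V
  have htop : (⊤ : Submodule ℂ (ExteriorAlgebra ℂ V)) =
      ⨆ i : Fin (N + 1), ⋀[ℂ]^(i : ℕ) V := by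
    refine le_antisymm (fun x _ => ?_) le_top
    rw [← sub_add_cancel x (algebraMap ℂ _ (ExteriorAlgebra.algebraMapInv x))]
    refine add_mem ((?_ : degreeGE V 1 ≤ _) (sub_algebraMapInv_mem_degreeGE x)) ?_
    · refine iSup_le fun i => ?_
      by_cases hi : 1 + i < N + 1
      · exact le_iSup (fun i : Fin (N + 1) => ⋀[ℂ]^(i : ℕ) V) ⟨1 + i, hi⟩
      · rw [exteriorPower_eq_bot (by omega)]
        exact bot_le
    · refine Submodule.mem_iSup_of_mem 0 ?_
      simp only [Fin.val_zero]
      rw [ExteriorAlgebra.exteriorPower, pow_zero, Submodule.mem_one]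
      exact ⟨_, rfl⟩
  rw [FiniteDimensional, Module.finite_def, htop, ← Module.Finite.iff_fg]
  infer_instance

end ExteriorAlgebraFiltration

section GradedStructure

variable (g : ExteriorAlgebra ℂ (GIdx L n → ℂ) ≃ₐ[ℂ] E)

/-- The grading involution of `E`. -/
def gradeInv : E →ₐ[ℂ] E :=
  (g.toAlgHom.comp (CliffordAlgebra.involute
    (Q := (0 : QuadraticForm ℂ (GIdx L n → ℂ))))).comp g.symm.toAlgHom

theorem gradeInv_apply (x : ExteriorAlgebra ℂ (GIdx L n → ℂ)) :
    gradeInv g (g x) = g (CliffordAlgebra.involute x) := by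
  simp [gradeInv]

theorem gradeInv_gen (v : GIdx L n → ℂ) : gradeInv g (gen g v) = -gen g v := by
  rw [gen, gradeInv_apply]
  erw [CliffordAlgebra.involute_ι]
  exact map_neg g _

theorem E_induction {C : E → Prop} (algebraMap : ∀ r, C (algebraMap ℂ E r))
    (gen : ∀ v, C (gen g v)) (mul : ∀ a b, C a → C b → C (a * b))
    (add : ∀ a b, C a → C b → C (a + b)) (x : E) : C x := by
  obtain ⟨x, rfl⟩ := g.surjective x
  induction x using ExteriorAlgebra.induction with
  | algebraMap r => simpa using algebraMap r
  | ι v => exact gen v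
  | mul a b ha hb => rw [map_mul]; exact mul _ _ ha hb
  | add a b ha hb => rw [map_add]; exact add _ _ ha hb


theorem finiteDimensional_of_equiv (g : ExteriorAlgebra ℂ (GIdx L n → ℂ) ≃ₐ[ℂ] E) :
    FiniteDimensional ℂ E :=
  Module.Finite.equiv (AlgEquiv.toLinearEquiv g)

theorem gen_mul_gen (v w : GIdx L n → ℂ) : gen g v * gen g w = -(gen g w * gen g v) := by
  rw [eq_neg_iff_add_eq_zero, gen, gen, ← map_mul g, ← map_mul g, ← map_add g,
    ExteriorAlgebra.ι_add_mul_swap, map_zero]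

theorem gen_mul (v : GIdx L n → ℂ) (x : E) : gen g v * x = gradeInv g x * gen g v := by
  induction x using E_induction g with
  | algebraMap r => rw [AlgHom.commutes, Algebra.commutes]
  | gen w => rw [gen_mul_gen, gradeInv_gen, neg_mul]
  | mul a b ha hb => rw [← mul_assoc, ha, mul_assoc, hb, map_mul, mul_assoc]
  | add a b ha hb => rw [mul_add, ha, hb, map_add, add_mul]

/-- `x` is homogeneous of the parity of `p`. -/
def HasParity (p : ℕ) (x : E) : Prop := gradeInv g x = (-1 : ℂ) ^ p • x

variable {g}

theorem HasParity.mul {p q : ℕ} {x y : E} (hx : HasParity g p x) (hy : HasParity g q y) :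
    HasParity g (p + q) (x * y) := by
  rw [HasParity, map_mul, hx, hy, smul_mul_smul_comm, pow_add]

theorem HasParity.add {p : ℕ} {x y : E} (hx : HasParity g p x) (hy : HasParity g p y) :
    HasParity g p (x + y) := by
  rw [HasParity, map_add, hx, hy, smul_add]

theorem HasParity.smul {p : ℕ} {x : E} (c : ℂ) (hx : HasParity g p x) :
    HasParity g p (c • x) := by
  rw [HasParity, map_smul, hx, smul_comm]

theorem HasParity.sub {p : ℕ} {x y : E} (hx : HasParity g p x) (hy : HasParity g p y) :
    HasParity g p (x - y) := by
  rw [HasParity, map_sub, hx, hy, smul_sub]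

theorem HasParity.zero (p : ℕ) : HasParity g p (0 : E) := by simp [HasParity]

theorem HasParity.one : HasParity g 0 (1 : E) := by simp [HasParity]

theorem HasParity.sum {ι : Type*} {p : ℕ} {s : Finset ι} {f : ι → E}
    (h : ∀ i ∈ s, HasParity g p (f i)) : HasParity g p (∑ i ∈ s, f i) := by
  classical
  induction s using Finset.induction_on with
  | empty => exact HasParity.zero p
  | insert a s ha ih =>
    rw [Finset.sum_insert ha]
    exact (h a (by simp)).add (ih fun i hi => h i (by simp [hi]))

theorem HasParity.congr {p q : ℕ} {x : E} (hx : HasParity g p x) (h : p % 2 = q % 2) :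
    HasParity g q x := by
  rw [HasParity, hx, neg_one_pow_eq_pow_mod_two, h, ← neg_one_pow_eq_pow_mod_two]

theorem hasParity_of_mem_evenPart {x : E} (hx : x ∈ evenPart g) : HasParity g 0 x := by
  obtain ⟨y, hy, rfl⟩ := hx
  change gradeInv g (g y) = _ • g y
  rw [gradeInv_apply, CliffordAlgebra.involute_eq_of_mem_even hy]
  simp

theorem hasParity_of_mem_oddPart {x : E} (hx : x ∈ oddPart g) : HasParity g 1 x := by
  obtain ⟨y, hy, rfl⟩ := hx
  change gradeInv g (g y) = _ • g y
  rw [gradeInv_apply, CliffordAlgebra.involute_eq_of_mem_odd hy]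
  simp

theorem HasParity.even_comm {x : E} (hx : HasParity g 0 x) (y : E) : x * y = y * x := by
  rw [HasParity, pow_zero, one_smul] at hx
  induction y using E_induction g with
  | algebraMap r => rw [Algebra.commutes]
  | gen w => rw [gen_mul, hx]
  | mul a b ha hb => rw [← mul_assoc, ha, mul_assoc, hb, mul_assoc]
  | add a b ha hb => rw [mul_add, ha, hb, add_mul]

theorem HasParity.odd_mul {x : E} (hx : HasParity g 1 x) (y : E) :
    x * y = gradeInv g y * x := by
  rw [HasParity, pow_one, neg_one_smul] at hx
  induction y using E_induction g with
  | algebraMap r => rw [AlgHom.commutes, Algebra.commutes]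
  | gen w => rw [gradeInv_gen, neg_mul, gen_mul, hx, neg_mul, neg_neg]
  | mul a b ha hb => rw [← mul_assoc, ha, mul_assoc, hb, map_mul, mul_assoc]
  | add a b ha hb => rw [mul_add, ha, hb, map_add, add_mul]

theorem HasParity.odd_anticomm {x y : E} (hx : HasParity g 1 x) (hy : HasParity g 1 y) :
    x * y = -(y * x) := by
  rw [hx.odd_mul, hy, pow_one, neg_one_smul, neg_mul]

variable (g)

theorem πB_apply (x : ExteriorAlgebra ℂ (GIdx L n → ℂ)) :
    πB g (g x) = ExteriorAlgebra.algebraMapInv x := by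
  simp [πB]

theorem πB_gradeInv (x : E) : πB g (gradeInv g x) = πB g x := by
  have hgen : ∀ v, πB g (gen g v) = 0 := fun v => by
    rw [gen, πB_apply]
    simp [ExteriorAlgebra.algebraMapInv, ExteriorAlgebra.lift_ι_apply]
  induction x using E_induction g with
  | algebraMap r => rw [AlgHom.commutes]
  | gen w => rw [gradeInv_gen, map_neg, hgen, neg_zero]
  | mul a b ha hb => rw [map_mul, map_mul, map_mul, ha, hb]
  | add a b ha hb => rw [map_add, map_add, map_add, ha, hb]

theorem HasParity.πB_eq_zero {g : ExteriorAlgebra ℂ (GIdx L n → ℂ) ≃ₐ[ℂ] E} {x : E}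
    (hx : HasParity g 1 x) : πB g x = 0 := by
  have h := πB_gradeInv g x
  rw [hx, pow_one, neg_one_smul, map_neg] at h
  exact self_eq_neg.mp h.symm

theorem πB_soul (x : E) : πB g (soul g x) = 0 := by
  simp [soul, AlgHom.commutes]

theorem soul_hasParity {x : E} (hx : HasParity g 0 x) : HasParity g 0 (soul g x) :=
  hx.sub (by simp [HasParity, AlgHom.commutes])

theorem prod_eq_zero_of_πB (l : List E) (hl : ∀ x ∈ l, πB g x = 0)
    (hlen : L + 3 * n < l.length) : l.prod = 0 := by
  have h := prod_mem_degreeGE (l.map g.symm) (fun x hx => by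
    obtain ⟨y, hy, rfl⟩ := List.mem_map.mp hx
    rw [← πB_apply g, g.apply_symm_apply, hl y hy])
  rw [degreeGE_eq_bot (by simp; omega), Submodule.mem_bot, ← map_list_prod] at h
  exact g.symm.map_eq_zero_iff.mp h

theorem pow_mul_eq_zero_of_πB {x y : E} (hx : πB g x = 0) (hy : πB g y = 0) :
    y * x ^ (L + 3 * n) = 0 := by
  rw [← List.prod_replicate, ← List.prod_cons]
  refine prod_eq_zero_of_πB g _ ?_ (by simp)
  intro z hz
  rcases List.mem_cons.mp hz with rfl | hz
  · exact hy
  · rw [List.eq_of_mem_replicate hz, hx]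

theorem Dop_mul (idx : GIdx L n) (x y : E) :
    Dop g idx (x * y) = Dop g idx x * y + gradeInv g x * Dop g idx y := by
  have hgen : ∀ v z, Dop g idx (gen g v * z) = v idx • z - gen g v * Dop g idx z := by
    intro v z
    obtain ⟨z, rfl⟩ := g.surjective z
    rw [gen, ← map_mul]
    simp only [Dop, LinearMap.comp_apply, AlgEquiv.toLinearMap_apply,
      AlgEquiv.symm_apply_apply]
    erw [CliffordAlgebra.contractLeft_ι_mul]
    rw [map_sub, map_smul, map_mul]
    rfl
  have hone : Dop g idx 1 = 0 := by
    simp only [Dop, LinearMap.comp_apply, AlgEquiv.toLinearMap_apply, map_one]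
    erw [CliffordAlgebra.contractLeft_one]
    exact map_zero g
  induction x using E_induction g generalizing y with
  | algebraMap r =>
    rw [AlgHom.commutes, Algebra.algebraMap_eq_smul_one, smul_one_mul, map_smul, map_smul, hone]
    simp
  | gen v =>
    have h1 := hgen v 1
    rw [mul_one, hone, mul_zero, sub_zero] at h1
    rw [hgen, h1, gradeInv_gen, smul_one_mul, neg_mul, sub_eq_add_neg]
  | mul a b ha hb =>
    rw [mul_assoc, ha, hb, ha, map_mul]
    noncomm_ring
  | add a b ha hb =>
    rw [add_mul, map_add, ha, hb, map_add, map_add]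
    noncomm_ring

theorem Dop_algebraMap (idx : GIdx L n) (r : ℂ) : Dop g idx (algebraMap ℂ E r) = 0 := by
  have h := Dop_mul g idx 1 1
  rw [mul_one, map_one (gradeInv g), mul_one, one_mul] at h
  rw [Algebra.algebraMap_eq_smul_one, map_smul, left_eq_add.mp h, smul_zero]

theorem Dop_gen (idx : GIdx L n) (v : GIdx L n → ℂ) :
    Dop g idx (gen g v) = algebraMap ℂ E (v idx) := by
  rw [gen]
  simp only [Dop, LinearMap.comp_apply, AlgEquiv.toLinearMap_apply,
      AlgEquiv.symm_apply_apply]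
  erw [CliffordAlgebra.contractLeft_ι]
  exact g.commutes _

theorem gradeInv_Dop (idx : GIdx L n) (x : E) :
    gradeInv g (Dop g idx x) = -Dop g idx (gradeInv g x) := by
  induction x using E_induction g with
  | algebraMap r => simp only [AlgHom.commutes, Dop_algebraMap, map_zero, neg_zero]
  | gen v => rw [gradeInv_gen, map_neg, neg_neg, Dop_gen, AlgHom.commutes]
  | mul a b ha hb =>
    rw [Dop_mul, map_add, map_mul, map_mul, map_mul, Dop_mul, ha, hb]
    noncomm_ring
  | add a b ha hb => rw [map_add, map_add, map_add, map_add, ha, hb]; abel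

theorem HasParity.Dop {g : ExteriorAlgebra ℂ (GIdx L n → ℂ) ≃ₐ[ℂ] E} {p : ℕ} {x : E}
    (hx : HasParity g p x) (idx : GIdx L n) : HasParity g (p + 1) (Dop g idx x) := by
  rw [HasParity, gradeInv_Dop, hx, map_smul, pow_succ, mul_neg_one, neg_smul]

theorem Dϑ_eq_zero_of_mem_ΛSub (k : Fin n) {x : E} (hx : x ∈ ΛSub g) : Dϑ g k x = 0 := by
  induction hx using Algebra.adjoin_induction with
  | mem x hx =>
    obtain ⟨i, rfl⟩ := hx
    rw [Dϑ, σg, Dop_gen]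
    simp
  | algebraMap r => exact Dop_algebraMap g _ r
  | add x y _ _ hx hy => rw [map_add, hx, hy, add_zero]
  | mul x y _ _ hx hy =>
    rw [Dϑ] at hx hy ⊢
    rw [Dop_mul, hx, hy, zero_mul, mul_zero, add_zero]

end GradedStructure

section Berezinian

variable {g : ExteriorAlgebra ℂ (GIdx L n → ℂ) ≃ₐ[ℂ] E}

variable (g) in
/-- The commutative subalgebra of even elements. -/
def evenSubalgebra : Subalgebra ℂ E where
  carrier := {x | HasParity g 0 x}
  mul_mem' hx hy := hx.mul hy
  add_mem' hx hy := hx.add hy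
  algebraMap_mem' r := by simp [HasParity, AlgHom.commutes]

instance : CommRing (evenSubalgebra g) where
  mul_comm x y := Subtype.ext (HasParity.even_comm x.2 y)

variable (g) in
/-- The subspace of odd elements. -/
def oddSubmodule : Submodule ℂ E where
  carrier := {x | HasParity g 1 x}
  add_mem' hx hy := hx.add hy
  zero_mem' := HasParity.zero 1
  smul_mem' c _ hx := hx.smul c

variable (g) in
/-- A matrix all of whose entries have the parity of `p`. -/
def MatParity {ι κ : Type*} (p : ℕ) (M : Matrix ι κ E) : Prop := ∀ i j, HasParity g p (M i j)

theorem MatParity.mul {ι κ τ : Type*} [Fintype κ] {p q : ℕ} {M : Matrix ι κ E}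
    {N : Matrix κ τ E} (hM : MatParity g p M) (hN : MatParity g q N) :
    MatParity g (p + q) (M * N) :=
  fun _ _ => HasParity.sum fun _ _ => (hM _ _).mul (hN _ _)

theorem MatParity.add {ι κ : Type*} {p : ℕ} {M N : Matrix ι κ E}
    (hM : MatParity g p M) (hN : MatParity g p N) : MatParity g p (M + N) :=
  fun i j => (hM i j).add (hN i j)

theorem MatParity.sub {ι κ : Type*} {p : ℕ} {M N : Matrix ι κ E}
    (hM : MatParity g p M) (hN : MatParity g p N) : MatParity g p (M - N) :=
  fun i j => (hM i j).sub (hN i j)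

theorem MatParity.one {ι : Type*} [DecidableEq ι] : MatParity g 0 (1 : Matrix ι ι E) := by
  intro i j
  rw [Matrix.one_apply]
  split_ifs
  exacts [HasParity.one, HasParity.zero 0]

theorem MatParity.congr {ι κ : Type*} {p q : ℕ} {M : Matrix ι κ E} (hM : MatParity g p M)
    (h : p % 2 = q % 2) : MatParity g q M :=
  fun i j => (hM i j).congr h

theorem MatParity.inv {ι : Type*} [Fintype ι] [DecidableEq ι] {M P : Matrix ι ι E}
    (hM : MatParity g 0 M) (h₁ : M * P = 1) (h₂ : P * M = 1) : MatParity g 0 P := by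
  have hM' : (gradeInv g).mapMatrix M = M := by
    ext i j
    simpa [HasParity] using hM i j
  have h := congrArg (gradeInv g).mapMatrix h₁
  rw [map_mul, map_one, hM'] at h
  have hP : (gradeInv g).mapMatrix P = P := by
    rw [← one_mul ((gradeInv g).mapMatrix P), ← h₂, mul_assoc, h, mul_one]
  intro i j
  have := congrFun (congrFun hP i) j
  simpa [HasParity] using this

theorem MatParity.exists_lift {ι κ : Type*} {M : Matrix ι κ E} (hM : MatParity g 0 M) :
    ∃ N : Matrix ι κ (evenSubalgebra g), N.map Subtype.val = M :=
  ⟨Matrix.of fun i j => ⟨M i j, hM i j⟩, rfl⟩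

theorem map_val_mul {ι κ τ : Type*} [Fintype κ] (M : Matrix ι κ (evenSubalgebra g))
    (N : Matrix κ τ (evenSubalgebra g)) :
    (M * N).map Subtype.val = M.map Subtype.val * N.map Subtype.val :=
  Matrix.map_mul (f := (evenSubalgebra g).val)

theorem map_val_one {ι : Type*} [DecidableEq ι] :
    (1 : Matrix ι ι (evenSubalgebra g)).map Subtype.val = 1 :=
  Matrix.map_one _ rfl rfl

theorem detE_map_val {k : ℕ} (M : Matrix (Fin k) (Fin k) (evenSubalgebra g)) :
    detE (M.map Subtype.val) = (M.det : E) := by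
  rw [Matrix.det_apply, detE, AddSubmonoidClass.coe_finsetSum]
  refine Finset.sum_congr rfl fun σ _ => ?_
  rw [← List.prod_ofFn]
  have h : ((List.ofFn fun i => M.map Subtype.val (σ i) i).prod : E)
      = (evenSubalgebra g).val (List.ofFn fun i => M (σ i) i).prod := by
    rw [map_list_prod, List.map_ofFn]
    rfl
  rw [h, Units.smul_def, ← map_zsmul]
  rfl

theorem detE_hasParity {k : ℕ} {M : Matrix (Fin k) (Fin k) E} (hM : MatParity g 0 M) :
    HasParity g 0 (detE M) := by
  obtain ⟨M, rfl⟩ := hM.exists_lift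
  rw [detE_map_val]
  exact M.det.2

theorem detE_mul {k : ℕ} {M N : Matrix (Fin k) (Fin k) E} (hM : MatParity g 0 M)
    (hN : MatParity g 0 N) : detE (M * N) = detE M * detE N := by
  obtain ⟨M, rfl⟩ := hM.exists_lift
  obtain ⟨N, rfl⟩ := hN.exists_lift
  rw [← map_val_mul, detE_map_val, detE_map_val, detE_map_val, Matrix.det_mul]
  rfl

theorem detE_one (g : ExteriorAlgebra ℂ (GIdx L n → ℂ) ≃ₐ[ℂ] E) {k : ℕ} :
    detE (1 : Matrix (Fin k) (Fin k) E) = 1 := by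
  rw [← map_val_one (g := g), detE_map_val, Matrix.det_one]
  rfl

theorem exists_inv_of_detE {k : ℕ} {M : Matrix (Fin k) (Fin k) E} {s : E}
    (hM : MatParity g 0 M) (hs : HasParity g 0 s) (h : detE M * s = 1) :
    ∃ N : Matrix (Fin k) (Fin k) E, MatParity g 0 N ∧ M * N = 1 ∧ N * M = 1 := by
  obtain ⟨M, rfl⟩ := hM.exists_lift
  have hu : IsUnit M.det := by
    refine IsUnit.of_mul_eq_one ⟨s, hs⟩ (Subtype.ext ?_)
    rw [detE_map_val] at h
    exact h
  refine ⟨(M⁻¹).map Subtype.val, fun i j => (M⁻¹ i j).2, ?_, ?_⟩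
  · rw [← map_val_mul, Matrix.mul_nonsing_inv _ hu, map_val_one]
  · rw [← map_val_mul, Matrix.nonsing_inv_mul _ hu, map_val_one]

theorem detE_one_add_vecMulVec {k : ℕ} {u v : Fin k → E} (hu : ∀ i, HasParity g 0 (u i))
    (hv : ∀ i, HasParity g 0 (v i)) :
    detE (1 + Matrix.of fun i j => u i * v j) = 1 + ∑ i, v i * u i := by
  let u' : Fin k → evenSubalgebra g := fun i => ⟨u i, hu i⟩
  let v' : Fin k → evenSubalgebra g := fun i => ⟨v i, hv i⟩
  have h := Matrix.det_one_add_replicateCol_mul_replicateRow (ι := Unit) u' v'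
  have hE := congrArg (evenSubalgebra g).val h
  rw [Subalgebra.val_apply, ← detE_map_val] at hE
  convert hE using 1
  · congr 1
    ext i j
    simp only [Matrix.map_apply, Matrix.add_apply, Matrix.mul_apply]
    simp [Matrix.one_apply, u', v', apply_ite]
  · simp [dotProduct, u', v']

/-- For odd matrices the even determinants `det (1 + UV)` and `det (1 + VU)` are inverse. -/
theorem detE_one_add_mul_comm_odd {k l : ℕ} {U : Matrix (Fin k) (Fin l) E}
    {V : Matrix (Fin l) (Fin k) E} (hU : MatParity g 1 U) (hV : MatParity g 1 V) :
    detE (1 + U * V) * detE (1 + V * U) = 1 := by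
  obtain ⟨V, rfl⟩ : ∃ W : Matrix (Fin l) (Fin k) (oddSubmodule g), W.map Subtype.val = V :=
    ⟨Matrix.of fun i j => ⟨V i j, hV i j⟩, rfl⟩
  clear hV
  induction V using Matrix.induction_on' generalizing U with
  | h_zero =>
    have : (0 : Matrix (Fin l) (Fin k) (oddSubmodule g)).map Subtype.val
      = (0 : Matrix (Fin l) (Fin k) E) := rfl
    rw [this, Matrix.mul_zero, Matrix.zero_mul, add_zero, add_zero, detE_one g, detE_one g,
      one_mul]
  | h_add V₁ V₂ h₁ h₂ =>
    have hadd : (V₁ + V₂).map Subtype.val = V₁.map Subtype.val + V₂.map Subtype.val := rfl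
    have hV₁ : MatParity g 1 (V₁.map Subtype.val) := fun i j => (V₁ i j).2
    have hV₂ : MatParity g 1 (V₂.map Subtype.val) := fun i j => (V₂ i j).2
    rw [hadd]
    specialize h₁ hU
    generalize V₁.map Subtype.val = W₁ at *
    generalize V₂.map Subtype.val = W₂ at *
    have e1 : MatParity g 0 (1 + U * W₁) := MatParity.one.add ((hU.mul hV₁).congr rfl)
    have e2 : MatParity g 0 (1 + W₁ * U) := MatParity.one.add ((hV₁.mul hU).congr rfl)
    obtain ⟨K, hK, hK₁, hK₂⟩ := exists_inv_of_detE e1 (detE_hasParity e2) h₁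
    have hKU : MatParity g 1 (K * U) := (hK.mul hU).congr rfl
    have a1 : 1 + U * (W₁ + W₂) = (1 + U * W₁) * (1 + K * U * W₂) := by
      rw [Matrix.mul_add (1 + U * W₁), Matrix.mul_assoc K, ← Matrix.mul_assoc _ K, hK₁,
        Matrix.one_mul, Matrix.mul_one, Matrix.mul_add, add_assoc]
    have a2 : 1 + (W₁ + W₂) * U = (1 + W₂ * (K * U)) * (1 + W₁ * U) := by
      have : U * (1 + W₁ * U) = (1 + U * W₁) * U := by
        rw [Matrix.mul_add, Matrix.add_mul, Matrix.mul_one, Matrix.one_mul, Matrix.mul_assoc]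
      rw [Matrix.add_mul 1, Matrix.one_mul, Matrix.mul_assoc W₂, Matrix.mul_assoc K, this,
        ← Matrix.mul_assoc K, hK₂, Matrix.one_mul, Matrix.add_mul, add_assoc]
    have e3 : MatParity g 0 (1 + K * U * W₂) := MatParity.one.add ((hKU.mul hV₂).congr rfl)
    have e4 : MatParity g 0 (1 + W₂ * (K * U)) := MatParity.one.add ((hV₂.mul hKU).congr rfl)
    rw [a1, a2, detE_mul e1 e3, detE_mul e4 e2]
    calc _ = detE (1 + U * W₁) * (detE (1 + K * U * W₂) * detE (1 + W₂ * (K * U)))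
          * detE (1 + W₁ * U) := by noncomm_ring
      _ = 1 := by rw [h₂ hKU, mul_one, h₁]
  | h_std_basis i j v =>
    have hs : (Matrix.single i j v).map Subtype.val = Matrix.single i j (v : E) := by
      ext a b
      simp only [Matrix.map_apply, Matrix.single_apply]
      split_ifs <;> rfl
    have hv : HasParity g 1 (v : E) := v.2
    have hsq : (v : E) * v = 0 := by
      have h := hv.odd_anticomm hv
      have h2 : (2 : ℂ) • ((v : E) * v) = 0 := by
        rw [two_smul]
        nth_rewrite 1 [h]
        exact neg_add_cancel _
      exact (smul_eq_zero.mp h2).resolve_left two_ne_zero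
    have hsi : ∀ (q : ℕ) (a : Fin q), ∀ b, HasParity g 0 ((Pi.single a 1 : Fin q → E) b) := by
      intro q a b
      rw [Pi.single_apply]
      split_ifs
      exacts [HasParity.one, HasParity.zero 0]
    have c1 : U * Matrix.single i j (v : E) =
        Matrix.of fun a b => (U a i * v) * (Pi.single j 1 : Fin k → E) b := by
      ext a b
      by_cases hb : j = b
      · subst hb; simp
      · rw [Matrix.mul_single_apply_of_ne _ _ _ _ _ (Ne.symm hb)]
        simp [Ne.symm hb]
    have c2 : Matrix.single i j (v : E) * U =
        Matrix.of fun a b => (Pi.single i 1 : Fin l → E) a * (v * U j b) := by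
      ext a b
      by_cases hb : i = a
      · subst hb; simp
      · rw [Matrix.single_mul_apply_of_ne _ _ _ _ _ (Ne.symm hb)]
        simp [Ne.symm hb]
    rw [hs, c1, c2, detE_one_add_vecMulVec (g := g) (fun a => ((hU a i).mul hv).congr rfl) (hsi _ _),
      detE_one_add_vecMulVec (g := g) (hsi _ _) (fun b => (hv.mul (hU j b)).congr rfl)]
    have s1 : ∑ x, (Pi.single j 1 : Fin k → E) x * (U x i * v) = U j i * v := by
      rw [Finset.sum_eq_single j] <;> simp +contextual
    have s2 : ∑ x, (v * U j x) * (Pi.single i 1 : Fin l → E) x = v * U j i := by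
      rw [Finset.sum_eq_single i] <;> simp +contextual
    rw [s1, s2, hv.odd_anticomm (hU j i)]
    have : U j i * (v : E) * (U j i * v) = 0 := by
      rw [mul_assoc, ← mul_assoc (v : E), hv.odd_anticomm (hU j i), neg_mul, mul_assoc, hsq]
      simp
    generalize U j i * (v : E) = z at this ⊢
    rw [mul_add, mul_one, mul_neg, add_mul, this, one_mul]
    abel

/-- Multiplicativity of the superdeterminant, expressed through given inverses. -/
theorem sdet_mul {k l : ℕ} {A A₁ A₂ P P₁ P₂ : Matrix (Fin k) (Fin k) E}
    {B B₁ B₂ : Matrix (Fin l) (Fin l) E} {C C₁ C₂ : Matrix (Fin k) (Fin l) E}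
    {D D₁ D₂ : Matrix (Fin l) (Fin k) E} {s s₁ s₂ : E}
    (hA₁ : MatParity g 0 A₁) (hB₁ : MatParity g 0 B₁) (hC₁ : MatParity g 1 C₁)
    (hD₁ : MatParity g 1 D₁) (hA₂ : MatParity g 0 A₂) (hB₂ : MatParity g 0 B₂)
    (hC₂ : MatParity g 1 C₂) (hD₂ : MatParity g 1 D₂)
    (hA : A = A₁ * A₂ + C₁ * D₂) (hC : C = A₁ * C₂ + C₁ * B₂)
    (hD : D = D₁ * A₂ + B₁ * D₂) (hB : B = D₁ * C₂ + B₁ * B₂)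
    (hP : A * P = 1 ∧ P * A = 1) (hP₁ : A₁ * P₁ = 1 ∧ P₁ * A₁ = 1)
    (hP₂ : A₂ * P₂ = 1 ∧ P₂ * A₂ = 1)
    (hs : detE (B - D * P * C) * s = 1)
    (hs₁ : detE (B₁ - D₁ * P₁ * C₁) * s₁ = 1 ∧ s₁ * detE (B₁ - D₁ * P₁ * C₁) = 1)
    (hs₂ : detE (B₂ - D₂ * P₂ * C₂) * s₂ = 1 ∧ s₂ * detE (B₂ - D₂ * P₂ * C₂) = 1) :
    detE A * s = (detE A₁ * s₁) * (detE A₂ * s₂) := by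
  have pP₁ := hA₁.inv hP₁.1 hP₁.2
  have pP₂ := hA₂.inv hP₂.1 hP₂.2
  obtain ⟨U, hU⟩ : ∃ U, U = P₁ * C₁ := ⟨_, rfl⟩
  obtain ⟨V, hV⟩ : ∃ V, V = D₂ * P₂ := ⟨_, rfl⟩
  have pU : MatParity g 1 U := hU ▸ (pP₁.mul hC₁).congr rfl
  have pV : MatParity g 1 V := hV ▸ (hD₂.mul pP₂).congr rfl
  have eC₁ : A₁ * U = C₁ := by rw [hU, ← Matrix.mul_assoc, hP₁.1, Matrix.one_mul]
  have eD₂ : V * A₂ = D₂ := by rw [hV, Matrix.mul_assoc, hP₂.2, Matrix.mul_one]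
  have pUV : MatParity g 0 (1 + U * V) := MatParity.one.add ((pU.mul pV).congr rfl)
  have pVU : MatParity g 0 (1 + V * U) := MatParity.one.add ((pV.mul pU).congr rfl)
  have hdet := detE_one_add_mul_comm_odd pU pV
  obtain ⟨K, pK, hK₁, hK₂⟩ := exists_inv_of_detE pUV (detE_hasParity pVU) hdet
  have eA : A = A₁ * (1 + U * V) * A₂ := by
    rw [hA, Matrix.mul_add, Matrix.add_mul, Matrix.mul_one, ← Matrix.mul_assoc A₁, eC₁,
      Matrix.mul_assoc C₁, eD₂]
  have eP : P = P₂ * K * P₁ := by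
    have h : A * (P₂ * K * P₁) = 1 := by
      calc A * (P₂ * K * P₁) = A₁ * ((1 + U * V) * (A₂ * P₂) * K) * P₁ := by
            rw [eA]; simp only [Matrix.mul_assoc]
        _ = 1 := by rw [hP₂.1, Matrix.mul_one, hK₁, Matrix.mul_one, hP₁.1]
    rw [← Matrix.mul_one P, ← h, ← Matrix.mul_assoc, hP.2, Matrix.one_mul]
  have pQ : MatParity g 0 (1 - V * K * U) :=
    MatParity.one.sub (((pV.mul pK).mul pU).congr rfl)
  have hQ : detE (1 - V * K * U) = detE (1 + U * V) := by
    have h : (1 - V * K * U) * (1 + V * U) = 1 := by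
      calc (1 - V * K * U) * (1 + V * U) = 1 + V * U - V * (K * (1 + U * V)) * U := by
            simp only [Matrix.mul_add, Matrix.sub_mul, Matrix.add_mul, Matrix.mul_one,
              Matrix.one_mul, Matrix.mul_assoc]
            abel
        _ = 1 := by rw [hK₂, Matrix.mul_one]; abel
    have h2 := congrArg detE h
    rw [detE_mul pQ pVU, detE_one g] at h2
    rw [← mul_one (detE (1 - V * K * U)), ← hdet, (detE_hasParity pUV).even_comm,
      ← mul_assoc, h2, one_mul]
  have eS : B - D * P * C
      = (B₁ - D₁ * P₁ * C₁) * (1 - V * K * U) * (B₂ - D₂ * P₂ * C₂) := by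
    have f1 : D * P₂ = D₁ + B₁ * V := by
      rw [hD, Matrix.add_mul, Matrix.mul_assoc, hP₂.1, Matrix.mul_one, Matrix.mul_assoc, ← hV]
    have f2 : P₁ * C = C₂ + U * B₂ := by
      rw [hC, Matrix.mul_add, ← Matrix.mul_assoc, hP₁.2, Matrix.one_mul, ← Matrix.mul_assoc, ← hU]
    have f3 : U * (1 - V * K * U) = K * U := by
      have : U * (1 - V * K * U) = U - (1 + U * V) * K * U + K * U := by
        simp only [Matrix.mul_sub, Matrix.add_mul, Matrix.mul_one, Matrix.one_mul,
          Matrix.mul_assoc]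
        abel
      rw [this, hK₁, Matrix.one_mul, sub_self, zero_add]
    have f4 : (1 - V * K * U) * V = V * K := by
      have : (1 - V * K * U) * V = V - V * (K * (1 + U * V)) + V * K := by
        simp only [Matrix.sub_mul, Matrix.mul_add, Matrix.mul_one, Matrix.one_mul,
          Matrix.mul_assoc]
        abel
      rw [this, hK₂, Matrix.mul_one, sub_self, zero_add]
    have f5 : K * U * V = 1 - K := by
      rw [eq_sub_iff_add_eq, ← hK₂, Matrix.mul_add, Matrix.mul_one, Matrix.mul_assoc, add_comm]
    calc B - D * P * C = B - (D * P₂) * K * (P₁ * C) := by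
          rw [eP]; simp only [Matrix.mul_assoc]
      _ = D₁ * C₂ + B₁ * B₂ - (D₁ + B₁ * V) * K * (C₂ + U * B₂) := by rw [f1, f2, hB]
      _ = B₁ * (1 - V * K * U) * B₂ - B₁ * (V * K) * C₂ - D₁ * (K * U) * B₂
          + D₁ * (1 - K) * C₂ := by
        simp only [Matrix.mul_sub, Matrix.sub_mul, Matrix.mul_add, Matrix.add_mul,
          Matrix.mul_one, Matrix.mul_assoc]
        abel
      _ = (B₁ - D₁ * U) * (1 - V * K * U) * (B₂ - V * C₂) := by
        have f6 : U * (1 - V * K * U) * V = 1 - K := by rw [f3, f5]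
        generalize 1 - V * K * U = Q at f3 f4 f6 ⊢
        rw [← f6, ← f4, ← f3]
        simp only [Matrix.mul_sub, Matrix.sub_mul, Matrix.mul_assoc]
        abel
      _ = _ := by rw [hU, hV, Matrix.mul_assoc D₁]
  have pS₁ : MatParity g 0 (B₁ - D₁ * P₁ * C₁) :=
    hB₁.sub (((hD₁.mul pP₁).mul hC₁).congr rfl)
  have pS₂ : MatParity g 0 (B₂ - D₂ * P₂ * C₂) :=
    hB₂.sub (((hD₂.mul pP₂).mul hC₂).congr rfl)
  rw [eS, detE_mul ((pS₁.mul pQ).congr rfl) pS₂, detE_mul pS₁ pQ, hQ] at hs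
  rw [eA, detE_mul ((hA₁.mul pUV).congr rfl) hA₂, detE_mul hA₁ pUV]
  have cS₂ := (detE_hasParity pS₂).even_comm
  have cA₂ := (detE_hasParity hA₂).even_comm
  generalize detE (B₁ - D₁ * P₁ * C₁) = σ₁ at *
  generalize detE (B₂ - D₂ * P₂ * C₂) = σ₂ at *
  generalize detE (1 + U * V) = d at *
  have hds : d * s = s₁ * s₂ := by
    calc d * s = (s₁ * σ₁) * d * s := by rw [hs₁.2, one_mul]
      _ = s₁ * (s₂ * σ₂) * σ₁ * d * s := by rw [hs₂.2, mul_one]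
      _ = s₁ * s₂ * (σ₂ * (σ₁ * d)) * s := by simp only [mul_assoc]
      _ = s₁ * s₂ * (σ₁ * d * σ₂ * s) := by rw [cS₂]; simp only [mul_assoc]
      _ = s₁ * s₂ := by rw [hs, mul_one]
  calc detE A₁ * d * detE A₂ * s = detE A₁ * (detE A₂ * (d * s)) := by
        rw [mul_assoc (detE A₁) d, ← cA₂ d]; simp only [mul_assoc]
    _ = detE A₁ * (detE A₂ * s₁) * s₂ := by rw [hds]; simp only [mul_assoc]
    _ = _ := by rw [cA₂ s₁]; simp only [mul_assoc]

end Berezinian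

section SkewDerivation

variable {R : Type*} [Ring R] [Algebra ℂ R]

/-- `H a a'` is a relational version of "`a'` is the value at `e` of a `τ`-twisted derivative
of `a`". -/
structure SkewDer (e : R →ₐ[ℂ] E) (τ : E →ₐ[ℂ] E) (H : R → E → Prop) : Prop where
  add : ∀ {a b a' b'}, H a a' → H b b' → H (a + b) (a' + b')
  smul : ∀ (c : ℂ) {a a'}, H a a' → H (c • a) (c • a')
  one : H 1 0
  mul : ∀ {a b a' b'}, H a a' → H b b' → H (a * b) (a' * e b + τ (e a) * b')

variable {e : R →ₐ[ℂ] E} {τ : E →ₐ[ℂ] E} {H : R → E → Prop}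

theorem SkewDer.sum (hH : SkewDer e τ H) {ι : Type*} (s : Finset ι) {f : ι → R} {f' : ι → E}
    (h : ∀ i ∈ s, H (f i) (f' i)) : H (∑ i ∈ s, f i) (∑ i ∈ s, f' i) := by
  classical
  induction s using Finset.induction_on with
  | empty => simpa using hH.smul 0 hH.one
  | insert i s hi ih =>
    rw [Finset.sum_insert hi, Finset.sum_insert hi]
    exact hH.add (h i (by simp)) (ih fun j hj => h j (by simp [hj]))

theorem SkewDer.list_prod (hH : SkewDer e τ H) {k : ℕ} (r : Fin k → R) (p t : Fin k → E)
    (ε : Fin k → ℂ) (hr : ∀ l, H (r l) (p l * t l))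
    (hε : ∀ j l, τ (e (r j)) * p l = ε j • (p l * e (r j))) :
    H (List.ofFn r).prod (∑ l, (∏ j, if j < l then ε j else 1) •
      (p l * (List.ofFn (Function.update (fun j => e (r j)) l (t l))).prod)) := by
  induction k with
  | zero => simpa using hH.one
  | succ k ih =>
    have ih := ih (fun j => r j.succ) (fun j => p j.succ) (fun j => t j.succ)
      (fun j => ε j.succ) (fun l => hr _) (fun j l => hε _ _)
    rw [List.ofFn_succ, List.prod_cons]
    convert hH.mul (hr 0) ih using 1
    rw [Fin.sum_univ_succ]
    congr 1
    · simp only [Fin.not_lt_zero, if_false, Finset.prod_const_one, one_smul, List.ofFn_succ,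
        List.prod_cons, Function.update_self, mul_assoc, map_list_prod, List.map_ofFn]
      congr 4
    · rw [Finset.mul_sum]
      refine Finset.sum_congr rfl fun l _ => ?_
      rw [Fin.prod_univ_succ, if_pos (Fin.succ_pos l), List.ofFn_succ, List.prod_cons,
        Function.update_of_ne (Fin.succ_ne_zero l).symm, mul_smul_comm, ← mul_assoc (τ _), hε,
        ← mul_assoc, smul_mul_assoc, smul_smul, mul_comm (ε 0)]
      simp only [Fin.succ_lt_succ_iff]
      congr 4
      funext j
      by_cases h : j = l
      · subst h; simp
      · rw [Function.update_of_ne h, Function.update_of_ne (fun h' => h (Fin.succ_injective _ h'))]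

theorem SkewDer.pow (hH : SkewDer e τ H) {s : R} {s' : E} (hs : H s s')
    (hτ : τ (e s) * s' = s' * e s) (k : ℕ) :
    H (s ^ k) (s' * ((k : ℂ) • e s ^ (k - 1))) := by
  have hτk : ∀ k : ℕ, τ (e s) ^ k * s' = s' * e s ^ k := by
    intro k
    induction k with
    | zero => simp
    | succ k ih => rw [pow_succ', mul_assoc, ih, ← mul_assoc, hτ, mul_assoc, ← pow_succ']
  induction k with
  | zero => simpa using hH.one
  | succ k ih =>
    rw [pow_succ]
    convert hH.mul ih hs using 1
    rw [map_pow, map_pow, hτk, mul_assoc, ← mul_add, smul_mul_assoc]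
    congr 1
    cases k with
    | zero => simp
    | succ k =>
      rw [Nat.add_sub_cancel, Nat.add_sub_cancel, ← pow_succ, Nat.cast_succ (k + 1), add_smul,
        one_smul]

theorem SkewDer.twist_list_prod {X : E} (l : List E) (h : ∀ x ∈ l, τ x * X = X * x) :
    τ l.prod * X = X * l.prod := by
  induction l with
  | nil => simp
  | cons x l ih =>
    rw [List.prod_cons, map_mul, mul_assoc, ih fun y hy => h y (by simp [hy]), ← mul_assoc,
      h x (by simp), mul_assoc]

/-- The truncated Taylor polynomial with derivatives `T` and increment `s`. -/
def taylor {A : Type*} [Ring A] [Algebra ℂ A] (M : ℕ) (T : (Fin m → ℕ) → A) (s : Fin m → A) : A :=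
  ∑ α ∈ Fintype.piFinset (fun _ : Fin m => Finset.range (M + 1)),
    (((∏ j, (α j).factorial : ℕ) : ℂ))⁻¹ • (T α * (List.ofFn fun j => s j ^ α j).prod)

theorem mul_list_prod_eq_zero {A : Type*} [Ring A] {z x : A} (l : List A) (hx : x ∈ l)
    (hz : z * x = 0) (hl : ∀ y ∈ l, z * y = y * z) : z * l.prod = 0 := by
  induction l with
  | nil => simp at hx
  | cons y l ih =>
    rw [List.prod_cons, ← mul_assoc]
    rcases List.mem_cons.mp hx with rfl | h
    · rw [hz, zero_mul]
    · rw [hl y (by simp), mul_assoc, ih h fun w hw => hl w (by simp [hw]), mul_zero]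

theorem SkewDer.taylor (hH : SkewDer e τ H) (M : ℕ) (T : (Fin m → ℕ) → R) (s : Fin m → R)
    (b s' : Fin m → E)
    (hT : ∀ α, H (T α) (∑ l, b l * e (T (α + Pi.single l 1))))
    (hs : ∀ l, H (s l) (s' l)) (hcen : ∀ l x, e (s l) * x = x * e (s l))
    (hτs : ∀ j l, τ (e (s j)) * s' l = s' l * e (s j))
    (hτT : ∀ α l, τ (e (T α)) * s' l = s' l * e (T α))
    (hz : ∀ l, s' l * e (s l) ^ M = 0) :
    H (_root_.taylor M T s) (∑ l, (b l + s' l) *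
      _root_.taylor M (fun α => e (T (α + Pi.single l 1))) (fun j => e (s j))) := by
  have hcen' : ∀ l k x, e (s l) ^ k * x = x * e (s l) ^ k := fun l k x =>
    ((show Commute (e (s l)) x from hcen l x).pow_left k).eq
  have hpow : ∀ (α : Fin m → ℕ) j l,
      τ (e (s j ^ α j)) * s' l = (1 : ℂ) • (s' l * e (s j ^ α j)) := by
    intro α j l
    rw [one_smul]
    rw [map_pow, ← List.prod_replicate]
    refine twist_list_prod _ fun x hx => ?_
    rw [List.eq_of_mem_replicate hx, hτs]
  have key := hH.sum (Fintype.piFinset (fun _ : Fin m => Finset.range (M + 1))) fun α _ =>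
    hH.smul ((((∏ j, (α j).factorial : ℕ) : ℂ))⁻¹) (hH.mul (hT α)
      (hH.list_prod (fun j => s j ^ α j) s' (fun l => (α l : ℂ) • e (s l) ^ (α l - 1)) (fun _ => 1)
        (fun l => hH.pow (hs l) (hτs l l) (α l)) (hpow α)))
  unfold _root_.taylor
  convert key using 1
  have hprod : ∀ (α : Fin m → ℕ) l, (List.ofFn (Function.update (fun j => e (s j ^ α j)) l
      ((α l : ℂ) • e (s l) ^ (α l - 1)))).prod =
      (α l : ℂ) • (List.ofFn fun j => e (s j) ^ (Function.update α l (α l - 1)) j).prod := by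
    intro α l
    have := (MultilinearMap.mkPiAlgebraFin ℂ m E).map_update_smul (fun j => e (s j ^ α j)) l
      (α l : ℂ) (e (s l) ^ (α l - 1))
    rw [MultilinearMap.mkPiAlgebraFin_apply, MultilinearMap.mkPiAlgebraFin_apply] at this
    rw [this]
    congr 3
    funext j
    by_cases h : j = l
    · subst h; simp
    · simp [Function.update_of_ne h]
  simp only [hprod, ite_self, Finset.prod_const_one, one_smul, smul_add, Finset.sum_add_distrib,
    add_mul]
  congr 1
  · simp only [Finset.mul_sum, Finset.sum_mul, Finset.smul_sum]
    rw [Finset.sum_comm]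
    refine Finset.sum_congr rfl fun α _ => Finset.sum_congr rfl fun l _ => ?_
    rw [mul_smul_comm, mul_assoc, map_list_prod, List.map_ofFn]
    congr 5
    funext j
    simp
  · simp only [Finset.mul_sum, Finset.smul_sum]
    rw [Finset.sum_comm (s := Fintype.piFinset _)]
    refine Finset.sum_congr rfl fun l _ => ?_
    rw [← Finset.sum_filter_of_ne (p := fun α => α l < M), eq_comm,
      ← Finset.sum_filter_of_ne (p := fun α => 0 < α l)]
    · refine Finset.sum_nbij' (fun α => Function.update α l (α l - 1)) (fun α => α + Pi.single l 1)
        ?_ ?_ ?_ ?_ ?_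
      · intro α hα
        simp only [Finset.mem_filter, Fintype.mem_piFinset, Finset.mem_range] at hα ⊢
        refine ⟨fun j => ?_, ?_⟩
        · by_cases h : j = l
          · subst h; have := hα.1 j; simp; omega
          · simpa [Function.update_of_ne h] using hα.1 j
        · have := hα.1 l; simp; omega
      · intro α hα
        simp only [Finset.mem_filter, Fintype.mem_piFinset, Finset.mem_range] at hα ⊢
        refine ⟨fun j => ?_, by simp⟩
        by_cases h : j = l
        · subst h; simpa using hα.2
        · simpa [h] using hα.1 j
      · intro α hα
        simp only [Finset.mem_filter] at hα
        funext j
        by_cases h : j = l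
        · subst h; simp; omega
        · simp [h]
      · intro α hα
        funext j
        by_cases h : j = l
        · subst h; simp
        · simp [h]
      · intro α hα
        simp only [Finset.mem_filter] at hα
        have h1 : Function.update α l (α l - 1) + Pi.single l 1 = α := by
          funext j
          by_cases h : j = l
          · subst h; simp; omega
          · simp [h]
        have h2 : ∏ j, (α j).factorial =
            α l * ∏ j, (Function.update α l (α l - 1) j).factorial := by
          rw [← Finset.mul_prod_erase _ _ (Finset.mem_univ l),
            ← Finset.mul_prod_erase _ (fun j => (Function.update α l (α l - 1) j).factorial)
              (Finset.mem_univ l), Function.update_self, ← mul_assoc,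
            Nat.mul_factorial_pred (by omega)]
          congr 1
          refine Finset.prod_congr rfl fun j hj => ?_
          rw [Function.update_of_ne (Finset.ne_of_mem_erase hj)]
        simp only [h1, h2, mul_smul_comm]
        rw [← mul_assoc, hτT, smul_smul, mul_assoc]
        congr 1
        have h3 : (α l : ℂ) ≠ 0 := by
          have : α l ≠ 0 := by omega
          exact_mod_cast this
        push_cast
        rw [mul_inv]
        field_simp
    · intro α _ h
      by_contra h0
      have h0 : α l = 0 := by omega
      simp [h0] at h
    · intro α hα h
      rw [Fintype.mem_piFinset] at hα
      have hM := Finset.mem_range.mp (hα l)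
      by_contra h0
      have h0 : α l = M := by omega
      refine h ?_
      rw [mul_smul_comm, ← mul_assoc, mul_list_prod_eq_zero (x := e (s l) ^ M), smul_zero]
      · rw [List.mem_ofFn]
        exact ⟨l, by rw [h0]⟩
      · rw [mul_assoc, ← hcen', ← mul_assoc, hz, zero_mul]
      · intro y hy
        obtain ⟨j, rfl⟩ := (List.mem_ofFn' _ _).mp hy
        exact (hcen' _ _ _).symm

theorem SkewDer.oddprod_mul (hH : SkewDer e τ H) (w : Fin n → R) (w' : Fin n → E)
    (G : (Fin n → Bool) → R) (X : Fin m → E) (Gd : (Fin n → Bool) → Fin m → E)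
    (hw : ∀ k, H (w k) (w' k)) (hG : ∀ a, H (G a) (∑ l, X l * Gd a l))
    (hτw : ∀ j l, τ (e (w j)) * w' l = -(w' l * e (w j)))
    (hτX : ∀ j l, τ (e (w j)) * X l = X l * e (w j)) :
    H (∑ a : Fin n → Bool, (List.ofFn fun k => if a k then w k else 1).prod * G a)
      (∑ l, X l * ∑ a, oddprod (fun k => e (w k)) a * Gd a l +
        ∑ l, w' l * ∑ a : Fin n → Bool, oddprod (fun k => e (w k)) a *
          (if a l then 0 else ((-1 : ℂ) ^ ((Finset.univ.filter fun k => k < l ∧ a k).card)) •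
            e (G (Function.update a l true)))) := by
  have h1 : ∀ (a : Fin n → Bool) l,
      H (if a l then w l else 1) (w' l * (if a l then 1 else 0)) := by
    intro a l
    split_ifs
    · simpa using hw l
    · simpa using hH.one
  have h2 : ∀ (a : Fin n → Bool) j l, τ (e (if a j then w j else 1)) * w' l =
      (if a j then (-1 : ℂ) else 1) • (w' l * e (if a j then w j else 1)) := by
    intro a j l
    split_ifs
    · rw [hτw, neg_smul, one_smul]
    · simp
  have key := hH.sum Finset.univ fun a (_ : a ∈ Finset.univ) =>
    hH.mul (hH.list_prod (fun k => if a k then w k else 1) w' _ _ (h1 a) (h2 a)) (hG a)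
  convert key using 1
  have hodd : ∀ a : Fin n → Bool, e (List.ofFn fun k => if a k then w k else 1).prod =
      oddprod (fun k => e (w k)) a := by
    intro a
    rw [oddprod, map_list_prod, List.map_ofFn]
    congr 2
    funext k
    simp only [Function.comp_apply]
    split_ifs <;> simp
  have hodd' : ∀ (a : Fin n → Bool) l, τ (oddprod (fun k => e (w k)) a) * X l =
      X l * oddprod (fun k => e (w k)) a := by
    intro a l
    refine twist_list_prod _ fun x hx => ?_
    obtain ⟨k, rfl⟩ := (List.mem_ofFn' _ _).mp hx
    dsimp only
    split_ifs
    · exact hτX k l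
    · simp
  have hupd : ∀ (a : Fin n → Bool) l, (List.ofFn (Function.update
      (fun j => e (if a j then w j else 1)) l (if a l then 1 else 0))).prod =
      if a l then oddprod (fun k => e (w k)) (Function.update a l false) else 0 := by
    intro a l
    split_ifs with h
    · rw [oddprod]
      congr 2
      funext j
      by_cases hj : j = l
      · subst hj; simp
      · rw [Function.update_of_ne hj, Function.update_of_ne hj]
        split_ifs <;> simp
    · refine List.prod_eq_zero ((List.mem_ofFn' _ _).mpr ⟨l, ?_⟩)
      rw [Function.update_self]
  have hsign : ∀ (a : Fin n → Bool) l,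
      (∏ j, if j < l then (if a j then (-1 : ℂ) else 1) else 1) =
      (-1 : ℂ) ^ ((Finset.univ.filter fun k => k < l ∧ a k).card) := by
    intro a l
    simp only [← ite_and]
    rw [Finset.prod_ite, Finset.prod_const, Finset.prod_const_one, mul_one]
  simp only [hodd, hupd, hsign]
  rw [Finset.sum_add_distrib, add_comm]
  congr 1
  · simp only [Finset.mul_sum, Finset.sum_mul]
    rw [Finset.sum_comm (γ := Fin n → Bool)]
    refine Finset.sum_congr rfl fun l _ => ?_
    rw [← Finset.sum_filter_of_ne (p := fun a => a l = false), eq_comm,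
      ← Finset.sum_filter_of_ne (p := fun a => a l = true)]
    · refine Finset.sum_nbij' (fun a => Function.update a l false)
        (fun a => Function.update a l true) ?_ ?_ ?_ ?_ ?_
      · intro a _; simp
      · intro a _; simp
      · intro a ha
        rw [Finset.mem_filter] at ha
        simp [← ha.2]
      · intro a ha
        rw [Finset.mem_filter] at ha
        simp [← ha.2]
      · intro a ha
        rw [Finset.mem_filter] at ha
        have hcard : (Finset.univ.filter fun k => k < l ∧ Function.update a l false k) =
            Finset.univ.filter fun k => k < l ∧ a k := by
          ext k
          simp only [Finset.mem_filter, Finset.mem_univ, true_and]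
          refine and_congr_right fun hk => ?_
          rw [Function.update_of_ne hk.ne]
        have hback : Function.update (Function.update a l false) l true = a := by
          simp [← ha.2]
        rw [hcard, hback, if_pos ha.2]
        simp [mul_assoc]
    · intro a _ h
      by_contra h0
      simp [h0] at h
    · intro a _ h
      by_contra h0
      simp [h0] at h
  · simp only [Finset.mul_sum]
    rw [Finset.sum_comm (γ := Fin n → Bool)]
    refine Finset.sum_congr rfl fun a _ => Finset.sum_congr rfl fun l _ => ?_
    rw [← mul_assoc, ← mul_assoc, hodd']

end SkewDerivation

section PartialDerivatives

theorem contDiffOn_pd {f : (Fin m → ℝ) → E} {W : Set (Fin m → ℝ)} (hW : IsOpen W)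
    (hf : ContDiffOn ℝ (⊤ : ℕ∞) f W) (j : Fin m) : ContDiffOn ℝ (⊤ : ℕ∞) (pd j f) W :=
  (hf.fderiv_of_isOpen hW (by simp)).clm_apply contDiffOn_const

theorem contDiffOn_pdIter {f : (Fin m → ℝ) → E} {W : Set (Fin m → ℝ)} (hW : IsOpen W)
    (hf : ContDiffOn ℝ (⊤ : ℕ∞) f W) (l : List (Fin m)) :
    ContDiffOn ℝ (⊤ : ℕ∞) (pdIter l f) W := by
  induction l generalizing f with
  | nil => exact hf
  | cons j l ih => exact ih (contDiffOn_pd hW hf j)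

theorem pd_congr {f f' : (Fin m → ℝ) → E} {W : Set (Fin m → ℝ)} (hW : IsOpen W)
    (h : Set.EqOn f f' W) (j : Fin m) : Set.EqOn (pd j f) (pd j f') W := fun q hq => by
  rw [pd, pd, Filter.EventuallyEq.fderiv_eq (h.eventuallyEq_of_mem (hW.mem_nhds hq))]

theorem pdIter_congr {f f' : (Fin m → ℝ) → E} {W : Set (Fin m → ℝ)} (hW : IsOpen W)
    (h : Set.EqOn f f' W) (l : List (Fin m)) : Set.EqOn (pdIter l f) (pdIter l f') W := by
  induction l generalizing f f' with
  | nil => exact h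
  | cons j l ih => exact ih (pd_congr hW h j)

theorem pd_comm {f : (Fin m → ℝ) → E} {W : Set (Fin m → ℝ)} (hW : IsOpen W)
    (hf : ContDiffOn ℝ (⊤ : ℕ∞) f W) (i j : Fin m) :
    Set.EqOn (pd i (pd j f)) (pd j (pd i f)) W := fun q hq => by
  have hd : DifferentiableAt ℝ (fderiv ℝ f) q :=
    ((hf.fderiv_of_isOpen hW (m := (⊤ : ℕ∞)) (by simp)).differentiableOn (by simp)).differentiableAt
      (hW.mem_nhds hq)
  have h : ∀ i j : Fin m, pd i (pd j f) q =
      fderiv ℝ (fderiv ℝ f) q (Pi.single i 1) (Pi.single j 1) := by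
    intro i j
    have := (hd.hasFDerivAt.clm_apply (hasFDerivAt_const (Pi.single j (1 : ℝ)) q)).fderiv
    rw [pd, show pd j f = fun p => fderiv ℝ f p (Pi.single j 1) from rfl, this]
    simp
  rw [h, h]
  exact ((hf.contDiffAt (hW.mem_nhds hq)).isSymmSndFDerivAt (by
    rw [minSmoothness_of_isRCLikeNormedField]; exact WithTop.coe_le_coe.mpr (le_top : (2 : ℕ∞) ≤ ⊤))).eq _ _

theorem pdIter_perm {f : (Fin m → ℝ) → E} {W : Set (Fin m → ℝ)} (hW : IsOpen W)
    (hf : ContDiffOn ℝ (⊤ : ℕ∞) f W) {l l' : List (Fin m)} (h : l.Perm l') :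
    Set.EqOn (pdIter l f) (pdIter l' f) W := by
  induction h generalizing f with
  | nil => exact fun _ _ => rfl
  | cons j _ ih => exact ih (contDiffOn_pd hW hf j)
  | swap i j l => exact pdIter_congr hW (pd_comm hW hf i j) l
  | trans _ _ ih₁ ih₂ => exact (ih₁ hf).trans (ih₂ hf)

theorem pdIter_append_singleton (l : List (Fin m)) (j : Fin m) (f : (Fin m → ℝ) → E) :
    pdIter (l ++ [j]) f = pd j (pdIter l f) := by
  simp [pdIter, List.foldl_append]

theorem count_mlist (α : Fin m → ℕ) (j : Fin m) : (mlist α).count j = α j := by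
  rw [mlist, List.count_flatMap]
  have : (List.count j ∘ fun i => List.replicate (α i) i) = fun i => if i = j then α j else 0 := by
    funext i
    simp only [Function.comp_apply, List.count_replicate, beq_iff_eq]
    split_ifs with h
    · rw [h]
    · rfl
  rw [this, ← List.ofFn_eq_map, List.sum_ofFn]
  simp

theorem mlist_add_single_perm (α : Fin m → ℕ) (l : Fin m) :
    (mlist (α + Pi.single l 1)).Perm (l :: mlist α) := by
  rw [List.perm_iff_count]
  intro j
  rw [count_mlist, List.count_cons, count_mlist]
  by_cases h : j = l
  · subst h; simp
  · simp [h, Ne.symm h]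

variable (g : ExteriorAlgebra ℂ (GIdx L n → ℂ) ≃ₐ[ℂ] E)
include g

theorem HasFDerivAt.linearMap_comp {F : Type*} [NormedAddCommGroup F] [NormedSpace ℝ F]
    (T : E →ₗ[ℝ] F) {f : (Fin m → ℝ) → E} {f' : (Fin m → ℝ) →L[ℝ] E} {q : Fin m → ℝ}
    (hf : HasFDerivAt f f' q) :
    ∃ G : (Fin m → ℝ) →L[ℝ] F, HasFDerivAt (fun p => T (f p)) G q ∧ ∀ v, G v = T (f' v) := by
  have : FiniteDimensional ℂ E := finiteDimensional_of_equiv g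
  have : FiniteDimensional ℝ E := FiniteDimensional.complexToReal E
  exact ⟨(LinearMap.toContinuousLinearMap T).comp f',
    (LinearMap.toContinuousLinearMap T).hasFDerivAt.comp q hf, fun v => rfl⟩

theorem pd_mem_ker (T : E →ₗ[ℂ] E) {f : (Fin m → ℝ) → E} (h : ∀ q, T (f q) = 0) (j : Fin m)
    (q : Fin m → ℝ) : T (pd j f q) = 0 := by
  by_cases hf : DifferentiableAt ℝ f q
  · obtain ⟨G, hG, hG'⟩ := HasFDerivAt.linearMap_comp g (T.restrictScalars ℝ) hf.hasFDerivAt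
    rw [pd]
    refine (hG' _).symm.trans ?_
    have h0 : (fun p => T.restrictScalars ℝ (f p)) = fun _ => 0 := funext h
    rw [h0] at hG
    rw [hG.unique (hasFDerivAt_const _ _)]
    rfl
  · rw [pd, fderiv_zero_of_not_differentiableAt hf]
    simp

theorem pdIter_mem_ker (T : E →ₗ[ℂ] E) {f : (Fin m → ℝ) → E} (h : ∀ q, T (f q) = 0)
    (l : List (Fin m)) (q : Fin m → ℝ) : T (pdIter l f q) = 0 := by
  induction l generalizing f with
  | nil => exact h q
  | cons j l ih => exact ih fun q => pd_mem_ker g T h j q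

variable {g}

theorem hasParity_iff_ker (p : ℕ) (x : E) : HasParity g p x ↔
    ((gradeInv g).toLinearMap - (-1 : ℂ) ^ p • LinearMap.id : E →ₗ[ℂ] E) x = 0 := by
  simp [HasParity, sub_eq_zero]

theorem HasParity.pd {p : ℕ} {f : (Fin m → ℝ) → E} (h : ∀ q, HasParity g p (f q)) (j : Fin m)
    (q : Fin m → ℝ) : HasParity g p (pd j f q) :=
  (hasParity_iff_ker p _).mpr (pd_mem_ker g _ (fun q => (hasParity_iff_ker p _).mp (h q)) j q)

theorem HasParity.pdIter {p : ℕ} {f : (Fin m → ℝ) → E} (h : ∀ q, HasParity g p (f q))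
    (l : List (Fin m)) (q : Fin m → ℝ) : HasParity g p (pdIter l f q) :=
  (hasParity_iff_ker p _).mpr (pdIter_mem_ker g _ (fun q => (hasParity_iff_ker p _).mp (h q)) l q)

end PartialDerivatives

section Parity

variable {g : ExteriorAlgebra ℂ (GIdx L n → ℂ) ≃ₐ[ℂ] E}

theorem HasParity.prod_ofFn {k : ℕ} {r : Fin k → E} {p : Fin k → ℕ}
    (h : ∀ j, HasParity g (p j) (r j)) : HasParity g (∑ j, p j) (List.ofFn r).prod := by
  induction k with
  | zero => simpa using HasParity.one
  | succ k ih =>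
    rw [List.ofFn_succ, List.prod_cons, Fin.sum_univ_succ]
    exact (h 0).mul (ih fun j => h j.succ)

theorem HasParity.pow_even {x : E} (hx : HasParity g 0 x) (k : ℕ) : HasParity g 0 (x ^ k) := by
  induction k with
  | zero => simpa using HasParity.one
  | succ k ih => rw [pow_succ]; exact ih.mul hx

theorem HasParity.oddprod {w : Fin n → E} (hw : ∀ k, HasParity g 1 (w k)) (a : Fin n → Bool) :
    HasParity g (mIdxCard a) (oddprod w a) := by
  rw [mIdxCard, Finset.card_filter]
  refine HasParity.prod_ofFn fun k => ?_
  split_ifs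
  exacts [hw k, HasParity.one]

theorem HasParity.gcont {p : ℕ} {f : (Fin m → ℝ) → E} (hf : ∀ q, HasParity g p (f q))
    {x : Fin m → E} (hx : ∀ j, HasParity g 0 (x j)) : HasParity g p (gcont g f x) := by
  refine HasParity.sum fun α _ => HasParity.smul _ ?_
  refine ((HasParity.pdIter hf _ _).mul (HasParity.prod_ofFn (p := fun _ => 0) fun j =>
    (soul_hasParity g (hx j)).pow_even (α j))).congr (by simp)

theorem HasParity.seval {p : ℕ} {c : (Fin n → Bool) → (Fin m → ℝ) → E}
    (hc : ∀ a q, HasParity g (mIdxCard a + p) (c a q)) {x : Fin m → E}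
    (hx : ∀ j, HasParity g 0 (x j)) {w : Fin n → E} (hw : ∀ k, HasParity g 1 (w k)) :
    HasParity g p (seval g c x w) :=
  HasParity.sum fun a _ => ((HasParity.oddprod hw a).mul (HasParity.gcont (hc a) hx)).congr
    (by omega)

theorem mIdxCard_update_true {b : Fin n → Bool} {l : Fin n} (h : b l = false) :
    mIdxCard (Function.update b l true) = mIdxCard b + 1 := by
  have : (Finset.univ.filter fun k => Function.update b l true k = true) =
      insert l (Finset.univ.filter fun k => b k = true) := by
    ext k
    by_cases hk : k = l
    · subst hk; simp
    · simp [hk]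
  rw [mIdxCard, this, Finset.card_insert_of_notMem (by simp [h]), mIdxCard]

theorem HasParity.oddDerivCoeff {p : ℕ} {c : (Fin n → Bool) → (Fin m → ℝ) → E}
    (hc : ∀ a q, HasParity g (mIdxCard a + p) (c a q)) (l : Fin n) (a : Fin n → Bool)
    (q : Fin m → ℝ) : HasParity g (mIdxCard a + (p + 1)) (oddDerivCoeff l c a q) := by
  rw [_root_.oddDerivCoeff]
  split_ifs with h
  · exact HasParity.zero _
  · refine ((hc _ q).congr ?_).smul _
    rw [mIdxCard_update_true (by simpa using h)]
    omega

theorem HasParity.ϑg (k : Fin n) : HasParity g 1 (ϑg g k) := by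
  simp [HasParity, _root_.ϑg, gradeInv_gen]

theorem hasParity_path {p : ℕ} {c : (Fin n → Bool) → (Fin m → ℝ) → E}
    (hc : ∀ a q, HasParity g (mIdxCard a + p) (c a q)) (q : Fin m → ℝ) :
    HasParity g p (∑ a : Fin n → Bool, ϑpow g a * c a q) :=
  HasParity.sum fun a _ =>
    ((HasParity.oddprod (HasParity.ϑg (g := g)) a).mul (hc a q)).congr (by omega)

theorem πB_path (c : (Fin n → Bool) → (Fin m → ℝ) → E) (q : Fin m → ℝ) :
    πB g (∑ a : Fin n → Bool, ϑpow g a * c a q) = πB g (c (fun _ => false) q) := by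
  rw [map_sum, Finset.sum_eq_single (fun _ => false)]
  · simp [ϑpow]
  · intro a _ ha
    obtain ⟨k, hk⟩ : ∃ k, a k = true := by
      by_contra! h
      exact ha (funext fun k => by simpa using h k)
    rw [map_mul, ϑpow, map_list_prod, List.prod_eq_zero, zero_mul]
    rw [List.map_ofFn, List.mem_ofFn']
    exact ⟨k, by simpa [hk] using (HasParity.ϑg (g := g) k).πB_eq_zero⟩
  · simp

end Parity

section ChainRule

variable {g : ExteriorAlgebra ℂ (GIdx L n → ℂ) ≃ₐ[ℂ] E}

theorem skewDer_Dϑ (l : Fin n) :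
    SkewDer (AlgHom.id ℂ E) (gradeInv g) (fun x x' => Dϑ g l x = x') where
  add := by rintro a b _ _ rfl rfl; exact map_add _ _ _
  smul := by rintro c a _ rfl; exact map_smul _ _ _
  one := by simpa [Dϑ] using Dop_algebraMap g (.inr (.inr (.inr l))) 1
  mul := by rintro a b _ _ rfl rfl; exact Dop_mul g _ _ _

/-- `f'` is the partial derivative of `f` at `q` in the direction `i`, and `f` is
differentiable there. -/
def HasPd (i : Fin m) (q : Fin m → ℝ) (f : (Fin m → ℝ) → E) (f' : E) : Prop :=
  ∃ F : (Fin m → ℝ) →L[ℝ] E, HasFDerivAt f F q ∧ F (Pi.single i 1) = f'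

theorem HasPd.pd_eq {i : Fin m} {q : Fin m → ℝ} {f : (Fin m → ℝ) → E} {f' : E}
    (h : HasPd i q f f') : pd i f q = f' := by
  obtain ⟨F, hF, rfl⟩ := h
  rw [pd, hF.fderiv]

theorem hasPd_of_contDiffOn {f : (Fin m → ℝ) → E} {W : Set (Fin m → ℝ)} (hW : IsOpen W)
    (hf : ContDiffOn ℝ (⊤ : ℕ∞) f W) {q : Fin m → ℝ} (hq : q ∈ W) (i : Fin m) :
    HasPd i q f (pd i f q) :=
  ⟨_, ((hf.differentiableOn (by simp)).differentiableAt (hW.mem_nhds hq)).hasFDerivAt, rfl⟩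

theorem skewDer_pd (i : Fin m) (q : Fin m → ℝ) :
    SkewDer (Pi.evalAlgHom ℂ (fun _ : Fin m → ℝ => E) q) (AlgHom.id ℂ E) (HasPd i q) where
  add := by
    rintro a b _ _ ⟨F, hF, rfl⟩ ⟨G, hG, rfl⟩
    exact ⟨_, hF.add hG, rfl⟩
  smul := by
    rintro c a _ ⟨F, hF, rfl⟩
    exact ⟨_, hF.const_smul c, rfl⟩
  one := ⟨0, hasFDerivAt_const _ _, rfl⟩
  mul := by
    rintro a b _ _ ⟨F, hF, rfl⟩ ⟨G, hG, rfl⟩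
    refine ⟨_, hF.mul' hG, ?_⟩
    simp [add_comm]

theorem HasPd.linearMap (g : ExteriorAlgebra ℂ (GIdx L n → ℂ) ≃ₐ[ℂ] E) (T : E →ₗ[ℂ] E)
    {i : Fin m} {q : Fin m → ℝ} {f : (Fin m → ℝ) → E} {f' : E} (h : HasPd i q f f') :
    HasPd i q (fun p => T (f p)) (T f') := by
  obtain ⟨F, hF, rfl⟩ := h
  obtain ⟨G, hG, hG'⟩ := HasFDerivAt.linearMap_comp g (T.restrictScalars ℝ) hF
  exact ⟨G, hG, hG' _⟩

theorem HasPd.hasParity {p : ℕ} {i : Fin m} {q : Fin m → ℝ} {f : (Fin m → ℝ) → E} {f' : E}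
    (h : HasPd i q f f') (hf : ∀ q, HasParity g p (f q)) : HasParity g p f' :=
  h.pd_eq ▸ HasParity.pd hf i q

/-- Taylor coefficients of the partial derivative `pd l f`. -/
theorem gcont_pd {f : (Fin m → ℝ) → E} {W : Set (Fin m → ℝ)} (hW : IsOpen W)
    (hf : ContDiffOn ℝ (⊤ : ℕ∞) f W) (l : Fin m) {x : Fin m → E} (hx : bodyVec g x ∈ W) :
    gcont g (pd l f) x = taylor (L + 3 * n)
      (fun α => pdIter (mlist (α + Pi.single l 1)) f (bodyVec g x)) (fun j => soul g (x j)) := by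
  refine Finset.sum_congr rfl fun α _ => ?_
  dsimp only
  rw [pdIter_perm hW hf (mlist_add_single_perm α l) hx]
  rfl

theorem Dϑ_gcont {f : (Fin m → ℝ) → E} {W : Set (Fin m → ℝ)} (hW : IsOpen W)
    (hf : ContDiffOn ℝ (⊤ : ℕ∞) f W) {l : Fin n} (hD : ∀ q, Dϑ g l (f q) = 0) {x : Fin m → E}
    (hx : bodyVec g x ∈ W) (hev : ∀ j, HasParity g 0 (x j)) :
    Dϑ g l (gcont g f x) = ∑ j, Dϑ g l (x j) * gcont g (pd j f) x := by
  have hs : ∀ j, Dϑ g l (soul g (x j)) = Dϑ g l (x j) := fun j => by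
    rw [soul, map_sub, Dϑ, Dop_algebraMap, sub_zero]
  have hodd : ∀ j, HasParity g 1 (Dϑ g l (x j)) := fun j => (hev j).Dop _
  have hcomm : ∀ j y, gradeInv g y * Dϑ g l (x j) = Dϑ g l (x j) * y := fun j y =>
    ((hodd j).odd_mul y).symm
  have := (skewDer_Dϑ (g := g) l).taylor (L + 3 * n)
    (fun α => pdIter (mlist α) f (bodyVec g x)) (fun j => soul g (x j)) (fun _ => 0)
    (fun j => Dϑ g l (x j)) (fun α => ?_) hs
    (fun j y => (soul_hasParity g (hev j)).even_comm y) (fun j k => hcomm k _)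
    (fun α k => hcomm k _)
    (fun j => pow_mul_eq_zero_of_πB g (πB_soul g _) (hodd j).πB_eq_zero)
  · refine Eq.trans this (Finset.sum_congr rfl fun j _ => ?_)
    rw [zero_add, gcont_pd hW hf j hx]
    rfl
  · simp only [zero_mul, Finset.sum_const_zero]
    exact pdIter_mem_ker g (Dϑ g l) hD _ _

theorem HasPd.gcont {f : (Fin m → ℝ) → E} {W : Set (Fin m → ℝ)} (hW : IsOpen W)
    (hf : ContDiffOn ℝ (⊤ : ℕ∞) f W) {i : Fin m} {q : Fin m → ℝ} {x : (Fin m → ℝ) → Fin m → E}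
    {x' : Fin m → E} (hx : bodyVec g (x q) ∈ W) (hev : ∀ p j, HasParity g 0 (x p j))
    (hx' : ∀ j, HasPd i q (fun p => x p j) (x' j))
    (hreal : ∀ j, ∀ᶠ p in nhds q, (πB g (x p j)).im = 0) :
    HasPd i q (fun p => gcont g f (x p)) (∑ j, x' j * gcont g (pd j f) (x q)) := by
  have hev' : ∀ j, HasParity g 0 (x' j) := fun j => (hx' j).hasParity fun p => hev p j
  choose X hX hXx using hx'
  have hB : ∀ j, ∃ G : (Fin m → ℝ) →L[ℝ] ℂ, HasFDerivAt (fun p => πB g (x p j)) G q ∧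
      ∀ v, G v = πB g (X j v) := fun j =>
    HasFDerivAt.linearMap_comp g ((πB g).toLinearMap.restrictScalars ℝ) (hX j)
  choose G hG hGv using hB
  have him : ∀ j, (πB g (x' j)).im = 0 := by
    intro j
    have h1 := Complex.imCLM.hasFDerivAt.comp q (hG j)
    have h2 : HasFDerivAt (fun p => (πB g (x p j)).im) (0 : (Fin m → ℝ) →L[ℝ] ℝ) q :=
      (hasFDerivAt_const 0 q).congr_of_eventuallyEq (hreal j)
    have := congrArg (fun T => T (Pi.single i 1)) (h1.unique h2)
    simpa [hGv, hXx] using this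
  have hbody : HasFDerivAt (fun p => bodyVec g (x p))
      (ContinuousLinearMap.pi fun j => Complex.reCLM.comp (G j)) q :=
    hasFDerivAt_pi.mpr fun j => Complex.reCLM.hasFDerivAt.comp q (hG j)
  have hsoul : ∀ j, HasPd i q (fun p => soul g (x p j)) (soul g (x' j)) := fun j =>
    HasPd.linearMap g (LinearMap.id - (Algebra.linearMap ℂ E).comp (πB g).toLinearMap)
      ⟨_, hX j, hXx j⟩
  have hcomm : ∀ j y, y * soul g (x' j) = soul g (x' j) * y := fun j y =>
    ((soul_hasParity g (hev' j)).even_comm y).symm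
  have := (skewDer_pd (E := E) i q).taylor (L + 3 * n)
    (fun α p => pdIter (mlist α) f (bodyVec g (x p))) (fun j p => soul g (x p j))
    (fun j => algebraMap ℂ E (πB g (x' j))) (fun j => soul g (x' j)) (fun α => ?_) hsoul
    (fun j y => (soul_hasParity g (hev q j)).even_comm y) (fun j k => hcomm k _)
    (fun α k => hcomm k _) (fun j => pow_mul_eq_zero_of_πB g (πB_soul g _) (πB_soul g _))
  · convert this using 1
    · funext p
      rw [taylor, Finset.sum_apply, _root_.gcont]
      refine Finset.sum_congr rfl fun α _ => ?_
      rw [Pi.smul_apply, Pi.mul_apply]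
      congr 2
      refine ((map_list_prod (Pi.evalAlgHom ℂ (fun _ : Fin m → ℝ => E) p) _).trans ?_).symm
      rw [List.map_ofFn]
      rfl
    · refine Finset.sum_congr rfl fun j _ => ?_
      rw [gcont_pd hW hf j hx, soul, add_sub_cancel]
      rfl
  · have hd := ((contDiffOn_pdIter hW hf (mlist α)).differentiableOn (by simp)).differentiableAt
      (hW.mem_nhds hx)
    refine ⟨_, hd.hasFDerivAt.comp q hbody, ?_⟩
    have hv : (ContinuousLinearMap.pi fun j => Complex.reCLM.comp (G j)) (Pi.single i 1) =
        ∑ j, (πB g (x' j)).re • (Pi.single j 1 : Fin m → ℝ) := by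
      funext k
      simp [hGv, hXx, Finset.sum_apply, Pi.single_apply]
    rw [ContinuousLinearMap.comp_apply, hv, map_sum]
    refine Finset.sum_congr rfl fun j _ => ?_
    rw [map_smul, Pi.evalAlgHom_apply, pdIter_perm hW hf
      ((mlist_add_single_perm α j).trans (List.perm_append_singleton j _).symm) hx,
      pdIter_append_singleton, ← Algebra.smul_def, pd]
    nth_rewrite 2 [← Complex.re_add_im (πB g (x' j))]
    rw [him j]
    simp

theorem gcont_smul (c : ℂ) (f : (Fin m → ℝ) → E) {W : Set (Fin m → ℝ)} (hW : IsOpen W)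
    (hf : ContDiffOn ℝ (⊤ : ℕ∞) f W) {x : Fin m → E} (hx : bodyVec g x ∈ W) :
    gcont g (fun q => c • f q) x = c • gcont g f x := by
  have h : ∀ (l : List (Fin m)) (f : (Fin m → ℝ) → E), ContDiffOn ℝ (⊤ : ℕ∞) f W →
      Set.EqOn (pdIter l fun q => c • f q) (fun q => c • pdIter l f q) W := by
    intro l
    induction l with
    | nil => exact fun _ _ _ _ => rfl
    | cons j l ih =>
      intro f hf q hq
      have h1 : Set.EqOn (pd j fun q => c • f q) (fun q => c • pd j f q) W := fun p hp =>
        ((skewDer_pd j p).smul c (hasPd_of_contDiffOn hW hf hp j)).pd_eq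
      exact (pdIter_congr hW h1 l hq).trans (ih _ (contDiffOn_pd hW hf j) hq)
  rw [gcont, gcont, Finset.smul_sum]
  refine Finset.sum_congr rfl fun α _ => ?_
  rw [h _ f hf hx, smul_mul_assoc, smul_comm]

theorem gcont_oddDerivCoeff {c : (Fin n → Bool) → (Fin m → ℝ) → E} {W : Set (Fin m → ℝ)}
    (hW : IsOpen W) (hc : ∀ a, ContDiffOn ℝ (⊤ : ℕ∞) (c a) W) {x : Fin m → E}
    (hx : bodyVec g x ∈ W) (l : Fin n) (a : Fin n → Bool) :
    gcont g (oddDerivCoeff l c a) x = if a l then 0 else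
      ((-1 : ℂ) ^ ((Finset.univ.filter fun k => k < l ∧ a k).card)) •
        gcont g (c (Function.update a l true)) x := by
  split_ifs with h
  · have : oddDerivCoeff l c a = fun q => (0 : ℂ) • c a q := by
      funext q
      simp [oddDerivCoeff, h]
    rw [this, gcont_smul _ _ hW (hc a) hx, zero_smul]
  · rw [← gcont_smul _ _ hW (hc _) hx]
    congr 1
    funext q
    simp [oddDerivCoeff, h]

theorem Dϑ_seval {c : (Fin n → Bool) → (Fin m → ℝ) → E} {W : Set (Fin m → ℝ)}
    (hW : IsOpen W) (hc : ∀ a, ContDiffOn ℝ (⊤ : ℕ∞) (c a) W) {l : Fin n}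
    (hD : ∀ a q, Dϑ g l (c a q) = 0) {x : Fin m → E} {w : Fin n → E}
    (hx : bodyVec g x ∈ W) (hev : ∀ j, HasParity g 0 (x j)) (hw : ∀ k, HasParity g 1 (w k)) :
    Dϑ g l (seval g c x w) = ∑ j, Dϑ g l (x j) * seval g (fun a => pd j (c a)) x w +
      ∑ k, Dϑ g l (w k) * seval g (oddDerivCoeff k c) x w := by
  have hw' : ∀ k, HasParity g 0 (Dϑ g l (w k)) := fun k => ((hw k).Dop _).congr rfl
  have hx' : ∀ j, HasParity g 1 (Dϑ g l (x j)) := fun j => (hev j).Dop _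
  have := (skewDer_Dϑ (g := g) l).oddprod_mul w (fun k => Dϑ g l (w k))
    (fun a => gcont g (c a) x) (fun j => Dϑ g l (x j)) (fun a j => gcont g (pd j (c a)) x)
    (fun _ => rfl) (fun a => Dϑ_gcont hW (hc a) (hD a) hx hev)
    (fun j k => by
      rw [AlgHom.id_apply, (hw' k).even_comm, hw j, pow_one, neg_one_smul, neg_mul])
    (fun j k => ((hx' k).odd_mul _).symm)
  refine Eq.trans this ?_
  simp only [seval, gcont_oddDerivCoeff hW hc hx]
  rfl

theorem HasPd.seval {c : (Fin n → Bool) → (Fin m → ℝ) → E} {W : Set (Fin m → ℝ)}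
    (hW : IsOpen W) (hc : ∀ a, ContDiffOn ℝ (⊤ : ℕ∞) (c a) W) {i : Fin m} {q : Fin m → ℝ}
    {x : (Fin m → ℝ) → Fin m → E} {x' : Fin m → E} {w : (Fin m → ℝ) → Fin n → E} {w' : Fin n → E}
    (hx : bodyVec g (x q) ∈ W) (hev : ∀ p j, HasParity g 0 (x p j))
    (hw : ∀ p k, HasParity g 1 (w p k)) (hx' : ∀ j, HasPd i q (fun p => x p j) (x' j))
    (hw' : ∀ k, HasPd i q (fun p => w p k) (w' k))
    (hreal : ∀ j, ∀ᶠ p in nhds q, (πB g (x p j)).im = 0) :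
    HasPd i q (fun p => seval g c (x p) (w p))
      (∑ j, x' j * seval g (fun a => pd j (c a)) (x q) (w q) +
        ∑ k, w' k * seval g (oddDerivCoeff k c) (x q) (w q)) := by
  have hev' : ∀ j, HasParity g 0 (x' j) := fun j => (hx' j).hasParity fun p => hev p j
  have hodd' : ∀ k, HasParity g 1 (w' k) := fun k => (hw' k).hasParity fun p => hw p k
  have := (skewDer_pd (E := E) i q).oddprod_mul (fun k p => w p k) w'
    (fun a p => _root_.gcont g (c a) (x p)) x' (fun a j => _root_.gcont g (pd j (c a)) (x q))
    hw' (fun a => HasPd.gcont hW (hc a) hx hev hx' hreal)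
    (fun j k => (hw q j).odd_anticomm (hodd' k)) (fun j k => ((hev' k).even_comm _).symm)
  convert this using 1
  · funext p
    rw [Finset.sum_apply, _root_.seval]
    refine Finset.sum_congr rfl fun a _ => ?_
    rw [Pi.mul_apply]
    congr 1
    refine ((map_list_prod (Pi.evalAlgHom ℂ (fun _ : Fin m → ℝ => E) p) _).trans ?_).symm
    rw [List.map_ofFn, oddprod]
    congr 2
    funext k
    simp only [Function.comp_apply]
    split_ifs <;> rfl
  · simp only [_root_.seval, gcont_oddDerivCoeff hW hc hx]
    rfl

end ChainRule

end SuperJacobian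

/-- **Change-of-variables formula for the contour (VV) integral over foliated singular
manifolds (Theorem CVF-VV).**  Let `γ` be a path from `Ω̃ = Ω × (ϑ₁,…,ϑₙ)` with
`sdet J(γ)` invertible and `𝔐 = γ(Ω̃)`.  Let `φ = (φ₀,φ₁)` be a supersmooth diffeomorphism
(with supersmooth inverse `ψ`, and `sdet J(φ)` invertible) from the superdomain neighborhood
`𝔒₁` (over `W₁`) of `𝔑 = δ(Ω̃)` onto the superdomain neighborhood `𝔒` (over `W`) of `𝔐`,
where `δ = φ⁻¹∘γ` is again a path with `sdet J(δ)` invertible.  Then for every supersmooth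
`u` integrable on `𝔐`,
`VV∬_𝔐 dxdθ u = VV∬_{φ⁻¹(𝔐)} dydω sdet J(φ)(y,ω)·u(φ(y,ω))`, i.e.
`∫_Ω dq [coeff of ϑ₁⋯ϑₙ in sdet J(γ)(q,ϑ)·u(γ(q,ϑ))]
  = ∫_Ω dq [coeff of ϑ₁⋯ϑₙ in sdet J(δ)(q,ϑ)·(sdet J(φ)·u∘φ)(δ(q,ϑ))]`,
all superdeterminants `sdet [[A,C],[D,B]] = det A·(det(B − D A⁻¹ C))⁻¹` being expressed
through the given (unique, two-sided) inverses. -/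
theorem vv_change_of_variables
    (g : ExteriorAlgebra ℂ (GIdx L n → ℂ) ≃ₐ[ℂ] E)
    (Ω : Set (Fin m → ℝ)) (hΩ : IsOpen Ω ∧ IsConnected Ω)
    (W W₁ : Set (Fin m → ℝ)) (hW : IsOpen W) (hW₁ : IsOpen W₁)
    -- the path γ, by ϑ-coefficient families
    (γ0c : Fin m → (Fin n → Bool) → (Fin m → ℝ) → E)
    (γ1c : Fin n → (Fin n → Bool) → (Fin m → ℝ) → E)
    (hγ0smooth : ∀ j a, ContDiffOn ℝ (⊤ : ℕ∞) (γ0c j a) Ω)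
    (hγ1smooth : ∀ k a, ContDiffOn ℝ (⊤ : ℕ∞) (γ1c k a) Ω)
    (hγ0Λ : ∀ j a q, γ0c j a q ∈ ΛSub g) (hγ1Λ : ∀ k a q, γ1c k a q ∈ ΛSub g)
    (hγ0parity : ∀ j a q,
      γ0c j a q ∈ (if mIdxCard a % 2 = 0 then evenPart g else oddPart g))
    (hγ1parity : ∀ k a q,
      γ1c k a q ∈ (if mIdxCard a % 2 = 0 then oddPart g else evenPart g))
    (hγ0bodyreal : ∀ j q, q ∈ Ω → (πB g (γ0c j (fun _ => false) q)).im = 0)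
    (hγbodymem : ∀ q ∈ Ω, bodyVec g (pathEv0 g γ0c q) ∈ W)
    (Pγ : (Fin m → ℝ) → Matrix (Fin m) (Fin m) E)
    (hPγ : ∀ q ∈ Ω, pathJA g γ0c q * Pγ q = 1 ∧ Pγ q * pathJA g γ0c q = 1)
    (sγ : (Fin m → ℝ) → E)
    (hsγ : ∀ q ∈ Ω, detE (pathSchur g γ0c γ1c (Pγ q) q) * sγ q = 1 ∧
      sγ q * detE (pathSchur g γ0c γ1c (Pγ q) q) = 1)
    -- the path δ, by ϑ-coefficient families
    (δ0c : Fin m → (Fin n → Bool) → (Fin m → ℝ) → E)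
    (δ1c : Fin n → (Fin n → Bool) → (Fin m → ℝ) → E)
    (hδ0smooth : ∀ j a, ContDiffOn ℝ (⊤ : ℕ∞) (δ0c j a) Ω)
    (hδ1smooth : ∀ k a, ContDiffOn ℝ (⊤ : ℕ∞) (δ1c k a) Ω)
    (hδ0Λ : ∀ j a q, δ0c j a q ∈ ΛSub g) (hδ1Λ : ∀ k a q, δ1c k a q ∈ ΛSub g)
    (hδ0parity : ∀ j a q,
      δ0c j a q ∈ (if mIdxCard a % 2 = 0 then evenPart g else oddPart g))
    (hδ1parity : ∀ k a q,
      δ1c k a q ∈ (if mIdxCard a % 2 = 0 then oddPart g else evenPart g))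
    (hδ0bodyreal : ∀ j q, q ∈ Ω → (πB g (δ0c j (fun _ => false) q)).im = 0)
    (hδbodymem : ∀ q ∈ Ω, bodyVec g (pathEv0 g δ0c q) ∈ W₁)
    (Pδ : (Fin m → ℝ) → Matrix (Fin m) (Fin m) E)
    (hPδ : ∀ q ∈ Ω, pathJA g δ0c q * Pδ q = 1 ∧ Pδ q * pathJA g δ0c q = 1)
    (sδ : (Fin m → ℝ) → E)
    (hsδ : ∀ q ∈ Ω, detE (pathSchur g δ0c δ1c (Pδ q) q) * sδ q = 1 ∧
      sδ q * detE (pathSchur g δ0c δ1c (Pδ q) q) = 1)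
    -- the supersmooth diffeomorphism φ from 𝔒₁ (over W₁) onto 𝔒 (over W)
    (φ0c : Fin m → (Fin n → Bool) → (Fin m → ℝ) → E)
    (φ1c : Fin n → (Fin n → Bool) → (Fin m → ℝ) → E)
    (hφ0smooth : ∀ i a, ContDiffOn ℝ (⊤ : ℕ∞) (φ0c i a) W₁)
    (hφ1smooth : ∀ k a, ContDiffOn ℝ (⊤ : ℕ∞) (φ1c k a) W₁)
    (hφ0Λ : ∀ i a q, φ0c i a q ∈ ΛSub g) (hφ1Λ : ∀ k a q, φ1c k a q ∈ ΛSub g)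
    (hφ0parity : ∀ i a q,
      φ0c i a q ∈ (if mIdxCard a % 2 = 0 then evenPart g else oddPart g))
    (hφ1parity : ∀ k a q,
      φ1c k a q ∈ (if mIdxCard a % 2 = 0 then oddPart g else evenPart g))
    (hφ0bodyreal : ∀ i q, q ∈ W₁ → (πB g (φ0c i (fun _ => false) q)).im = 0)
    (hφbodymaps : ∀ q ∈ W₁, (fun i => (πB g (φ0c i (fun _ => false) q)).re) ∈ W)
    -- φ possesses a supersmooth inverse ψ (so φ : 𝔒₁ → 𝔒 is a diffeomorphism)
    (ψ0c : Fin m → (Fin n → Bool) → (Fin m → ℝ) → E)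
    (ψ1c : Fin n → (Fin n → Bool) → (Fin m → ℝ) → E)
    (hψ0smooth : ∀ i a, ContDiffOn ℝ (⊤ : ℕ∞) (ψ0c i a) W)
    (hψ1smooth : ∀ k a, ContDiffOn ℝ (⊤ : ℕ∞) (ψ1c k a) W)
    (hψ0Λ : ∀ i a q, ψ0c i a q ∈ ΛSub g) (hψ1Λ : ∀ k a q, ψ1c k a q ∈ ΛSub g)
    (hψφ : ∀ (y : Fin m → E) (w : Fin n → E), SPts g W₁ y w →
      (∀ i, seval g (ψ0c i) (fun i' => seval g (φ0c i') y w)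
          (fun k' => seval g (φ1c k') y w) = y i) ∧
      (∀ k, seval g (ψ1c k) (fun i' => seval g (φ0c i') y w)
          (fun k' => seval g (φ1c k') y w) = w k))
    (hφψ : ∀ (x : Fin m → E) (t : Fin n → E), SPts g W x t →
      (∀ i, seval g (φ0c i) (fun i' => seval g (ψ0c i') x t)
          (fun k' => seval g (ψ1c k') x t) = x i) ∧
      (∀ k, seval g (φ1c k) (fun i' => seval g (ψ0c i') x t)
          (fun k' => seval g (ψ1c k') x t) = t k))
    -- δ = φ⁻¹ ∘ γ
    (hδφγ : ∀ q ∈ Ω,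
      (∀ j, seval g (φ0c j) (pathEv0 g δ0c q) (pathEv1 g δ1c q)
          = pathEv0 g γ0c q j) ∧
      (∀ k, seval g (φ1c k) (pathEv0 g δ0c q) (pathEv1 g δ1c q)
          = pathEv1 g γ1c q k))
    -- invertibility of sdet J(φ) along δ(Ω̃)
    (Pφ : (Fin m → ℝ) → Matrix (Fin m) (Fin m) E)
    (hPφ : ∀ q ∈ Ω,
      mapJyy g φ0c (pathEv0 g δ0c q) (pathEv1 g δ1c q) * Pφ q = 1 ∧
      Pφ q * mapJyy g φ0c (pathEv0 g δ0c q) (pathEv1 g δ1c q) = 1)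
    (Sφ : (Fin m → ℝ) → E)
    (hSφ : ∀ q ∈ Ω,
      detE (mapSchur g φ0c φ1c (Pφ q) (pathEv0 g δ0c q) (pathEv1 g δ1c q)) * Sφ q = 1 ∧
      Sφ q * detE (mapSchur g φ0c φ1c (Pφ q) (pathEv0 g δ0c q) (pathEv1 g δ1c q)) = 1)
    -- the supersmooth integrand u on the neighborhood 𝔒 of 𝔐, integrable on 𝔐
    (F : (Fin n → Bool) → (Fin m → ℝ) → E)
    (hFsmooth : ∀ a, ContDiffOn ℝ (⊤ : ℕ∞) (F a) W)
    (hFΛ : ∀ a q, F a q ∈ ΛSub g)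
    (hFint : IntegrableOn (fun q =>
      Bϑ g ((detE (pathJA g γ0c q) * sγ q)
        * ∑ a : Fin n → Bool,
            oddprod (pathEv1 g γ1c q) a * gcont g (F a) (pathEv0 g γ0c q))) Ω volume) :
    (∫ q in Ω,
      Bϑ g ((detE (pathJA g γ0c q) * sγ q)
        * ∑ a : Fin n → Bool,
            oddprod (pathEv1 g γ1c q) a * gcont g (F a) (pathEv0 g γ0c q)))
      = ∫ q in Ω,
          Bϑ g ((detE (pathJA g δ0c q) * sδ q)
            * ((detE (mapJyy g φ0c (pathEv0 g δ0c q) (pathEv1 g δ1c q)) * Sφ q)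
              * ∑ a : Fin n → Bool,
                  oddprod (fun k => seval g (φ1c k) (pathEv0 g δ0c q) (pathEv1 g δ1c q)) a
                    * gcont g (F a)
                        (fun j => seval g (φ0c j) (pathEv0 g δ0c q)
                          (pathEv1 g δ1c q)))) := by
  refine setIntegral_congr_fun hΩ.1.measurableSet fun q hq => ?_
  obtain ⟨hδφ0, hδφ1⟩ := hδφγ q hq
  have par0 : ∀ {c : (Fin n → Bool) → (Fin m → ℝ) → E} (_ : ∀ a q,
      c a q ∈ (if mIdxCard a % 2 = 0 then evenPart g else oddPart g)) (a : Fin n → Bool)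
      (q : Fin m → ℝ), HasParity g (mIdxCard a + 0) (c a q) := by
    intro c hc a q
    have := hc a q
    split_ifs at this with h
    · exact (hasParity_of_mem_evenPart this).congr (by omega)
    · exact (hasParity_of_mem_oddPart this).congr (by omega)
  have par1 : ∀ {c : (Fin n → Bool) → (Fin m → ℝ) → E} (_ : ∀ a q,
      c a q ∈ (if mIdxCard a % 2 = 0 then oddPart g else evenPart g)) (a : Fin n → Bool)
      (q : Fin m → ℝ), HasParity g (mIdxCard a + 1) (c a q) := by
    intro c hc a q
    have := hc a q
    split_ifs at this with h
    · exact (hasParity_of_mem_oddPart this).congr (by omega)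
    · exact (hasParity_of_mem_evenPart this).congr (by omega)
  have hx : ∀ p j, HasParity g 0 (pathEv0 g δ0c p j) := fun p j =>
    hasParity_path (par0 (hδ0parity j)) p
  have hw : ∀ p k, HasParity g 1 (pathEv1 g δ1c p k) := fun p k =>
    hasParity_path (par1 (hδ1parity k)) p
  have hpath : ∀ {c : (Fin n → Bool) → (Fin m → ℝ) → E}
      (_ : ∀ a, ContDiffOn ℝ (⊤ : ℕ∞) (c a) Ω) (i : Fin m),
      HasPd i q (fun p => ∑ a : Fin n → Bool, ϑpow g a * c a p)
        (pd i (fun p => ∑ a : Fin n → Bool, ϑpow g a * c a p) q) := fun hc i =>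
    hasPd_of_contDiffOn hΩ.1 (ContDiffOn.sum fun a _ => contDiffOn_const.mul (hc a)) hq i
  have hreal : ∀ j, ∀ᶠ p in nhds q, (πB g (pathEv0 g δ0c p j)).im = 0 := fun j =>
    Filter.eventually_of_mem (hΩ.1.mem_nhds hq) fun p hp => by
      rw [pathEv0, πB_path]
      exact hδ0bodyreal j p hp
  have chain_q : ∀ {c d : (Fin n → Bool) → (Fin m → ℝ) → E}
      (_ : ∀ a, ContDiffOn ℝ (⊤ : ℕ∞) (c a) W₁)
      (_ : ∀ p ∈ Ω, seval g c (pathEv0 g δ0c p) (pathEv1 g δ1c p) = ∑ a, ϑpow g a * d a p)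
      (i : Fin m),
      pd i (fun p => ∑ a, ϑpow g a * d a p) q =
        ∑ j, pathJA g δ0c q i j * seval g (fun a => pd j (c a)) (pathEv0 g δ0c q)
            (pathEv1 g δ1c q) +
          ∑ k, pd i (fun p => ∑ a, ϑpow g a * δ1c k a p) q *
            seval g (oddDerivCoeff k c) (pathEv0 g δ0c q) (pathEv1 g δ1c q) :=
    fun hc hd i => (pd_congr hΩ.1 (fun p hp => (hd p hp).symm) i hq).trans
      (HasPd.seval hW₁ hc (hδbodymem q hq) hx hw (fun j => hpath (hδ0smooth j) i)
        (fun k => hpath (hδ1smooth k) i) hreal).pd_eq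
  have chain_ϑ : ∀ {c d : (Fin n → Bool) → (Fin m → ℝ) → E}
      (_ : ∀ a, ContDiffOn ℝ (⊤ : ℕ∞) (c a) W₁) (_ : ∀ a p, c a p ∈ ΛSub g)
      (_ : seval g c (pathEv0 g δ0c q) (pathEv1 g δ1c q) = ∑ a, ϑpow g a * d a q)
      (l : Fin n),
      Dϑ g l (∑ a, ϑpow g a * d a q) =
        ∑ j, Dϑ g l (pathEv0 g δ0c q j) * seval g (fun a => pd j (c a)) (pathEv0 g δ0c q)
            (pathEv1 g δ1c q) +
          ∑ k, Dϑ g l (pathEv1 g δ1c q k) *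
            seval g (oddDerivCoeff k c) (pathEv0 g δ0c q) (pathEv1 g δ1c q) :=
    fun hc hΛ hd l => (congrArg _ hd.symm).trans
      (Dϑ_seval hW₁ hc (fun a p => Dϑ_eq_zero_of_mem_ΛSub g l (hΛ a p)) (hδbodymem q hq)
        (hx q) (hw q))
  have hsdet : detE (pathJA g γ0c q) * sγ q = (detE (pathJA g δ0c q) * sδ q) *
      (detE (mapJyy g φ0c (pathEv0 g δ0c q) (pathEv1 g δ1c q)) * Sφ q) := by
    refine sdet_mul (g := g)
      (B₁ := Matrix.of fun l k => Dϑ g l (∑ a : Fin n → Bool, ϑpow g a * δ1c k a q))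
      (B₂ := Matrix.of fun l k =>
        seval g (oddDerivCoeff l (φ1c k)) (pathEv0 g δ0c q) (pathEv1 g δ1c q))
      (C₁ := Matrix.of fun i k => pd i (fun p => ∑ a : Fin n → Bool, ϑpow g a * δ1c k a p) q)
      (C₂ := Matrix.of fun i k =>
        seval g (fun a => pd i (φ1c k a)) (pathEv0 g δ0c q) (pathEv1 g δ1c q))
      (D₁ := Matrix.of fun l j => Dϑ g l (∑ a : Fin n → Bool, ϑpow g a * δ0c j a q))
      (D₂ := Matrix.of fun l j =>
        seval g (oddDerivCoeff l (φ0c j)) (pathEv0 g δ0c q) (pathEv1 g δ1c q))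
      ?_ ?_ ?_ ?_ ?_ ?_ ?_ ?_ ?_ ?_ ?_ ?_ (hPγ q hq) (hPδ q hq) (hPφ q hq)
      (hsγ q hq).1 (hsδ q hq) (hSφ q hq)
    · exact fun i j => HasParity.pd (fun p => hx p j) i q
    · exact fun l k => ((hw q k).Dop _).congr rfl
    · exact fun i k => HasParity.pd (fun p => hw p k) i q
    · exact fun l j => (hx q j).Dop _
    · exact fun i j => HasParity.seval
        (fun a => HasParity.pd (par0 (hφ0parity j) a) i) (hx q) (hw q)
    · exact fun l k => (HasParity.seval
        (HasParity.oddDerivCoeff (par1 (hφ1parity k)) l) (hx q) (hw q)).congr rfl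
    · exact fun i k => HasParity.seval
        (fun a => HasParity.pd (par1 (hφ1parity k) a) i) (hx q) (hw q)
    · exact fun l j => HasParity.seval
        (HasParity.oddDerivCoeff (par0 (hφ0parity j)) l) (hx q) (hw q)
    · ext i j
      exact chain_q (hφ0smooth j) (fun p hp => (hδφγ p hp).1 j) i
    · ext i k
      exact chain_q (hφ1smooth k) (fun p hp => (hδφγ p hp).2 k) i
    · ext l j
      exact chain_ϑ (hφ0smooth j) (hφ0Λ j) (hδφ0 j) l
    · ext l k
      exact chain_ϑ (hφ1smooth k) (hφ1Λ k) (hδφ1 k) l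
  rw [hsdet, mul_assoc, funext hδφ0, funext hδφ1]
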